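/- arXiv:1709.10005 — 2 statements merged into one kernel-verified Lean document; each statement's English description precedes it below -/
import Mathlib

section
/- Let N ≥ 2, 1 < p < ∞, p' = p/(p−1), α = (N−p)/(p−1), R > 0, and let u be a bounded viscosity solution of problem (P) in the open ball B_R of radius R centered at the origin of ℝ^N. Then for every ε > 0 and every x ∈ B̄_R, ε^{−2}·∫₀^∞ u(x,τ)·e^{−τ/ε²} dτ = (∫₀^π e^{√p'·(|x|/ε)·cos θ}(sin θ)^α dθ)/(∫₀^π e^{√p'·(R/ε)·cos θ}(sin θ)^α dθ). -/
open MeasureTheory Metric Set Filter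
open scoped Topology ENNReal NNReal Real Classical

noncomputable section

/-- The Hessian matrix of a real-valued function, via the second iterated Fréchet derivative. -/
noncomputable def hess {N : ℕ} (f : EuclideanSpace ℝ (Fin N) → ℝ) (x : EuclideanSpace ℝ (Fin N)) :
    Matrix (Fin N) (Fin N) ℝ :=
  fun i j => iteratedFDeriv ℝ 2 f x ![EuclideanSpace.single i 1, EuclideanSpace.single j 1]

/-- The quadratic form ⟨Xv, v⟩ associated to a matrix. -/
noncomputable def qform {N : ℕ} (X : Matrix (Fin N) (Fin N) ℝ) (v : EuclideanSpace ℝ (Fin N)) : ℝ :=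
  ∑ i, ∑ j, X i j * v j * v i

/-- Smallest eigenvalue (via the Rayleigh quotient) of a symmetric matrix. -/
noncomputable def lamMin {N : ℕ} (X : Matrix (Fin N) (Fin N) ℝ) : ℝ :=
  sInf {r | ∃ v : EuclideanSpace ℝ (Fin N), ‖v‖ = 1 ∧ r = qform X v}

/-- Largest eigenvalue (via the Rayleigh quotient) of a symmetric matrix. -/
noncomputable def lamMax {N : ℕ} (X : Matrix (Fin N) (Fin N) ℝ) : ℝ :=
  sSup {r | ∃ v : EuclideanSpace ℝ (Fin N), ‖v‖ = 1 ∧ r = qform X v}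

/-- F(ξ, X) = (1/p)[tr X + (p−2)⟨Xξ,ξ⟩/|ξ|²]. -/
noncomputable def Fop {N : ℕ} (p : ℝ) (ξ : EuclideanSpace ℝ (Fin N))
    (X : Matrix (Fin N) (Fin N) ℝ) : ℝ :=
  (1/p) * (Matrix.trace X + (p - 2) * qform X ξ / ‖ξ‖^2)

/-- Lower semicontinuous relaxation F_*. -/
noncomputable def Flower {N : ℕ} (p : ℝ) (ξ : EuclideanSpace ℝ (Fin N))
    (X : Matrix (Fin N) (Fin N) ℝ) : ℝ :=
  if ξ = 0 then
    (1/p) * (Matrix.trace X + max (p - 2) 0 * lamMin X + min (p - 2) 0 * lamMax X)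
  else Fop p ξ X

/-- Upper semicontinuous relaxation F^*. -/
noncomputable def Fupper {N : ℕ} (p : ℝ) (ξ : EuclideanSpace ℝ (Fin N))
    (X : Matrix (Fin N) (Fin N) ℝ) : ℝ :=
  if ξ = 0 then
    (1/p) * (Matrix.trace X + min (p - 2) 0 * lamMin X + max (p - 2) 0 * lamMax X)
  else Fop p ξ X

/-- Viscosity solution of `u_t = Δ_p^G u` in `Ω × (0,∞)`. -/
def IsViscositySol {N : ℕ} (p : ℝ) (Ω : Set (EuclideanSpace ℝ (Fin N)))
    (u : EuclideanSpace ℝ (Fin N) → ℝ → ℝ) : Prop :=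
  ContinuousOn (fun q : EuclideanSpace ℝ (Fin N) × ℝ => u q.1 q.2) (Ω ×ˢ Set.Ioi 0) ∧
  (∀ φ : EuclideanSpace ℝ (Fin N) × ℝ → ℝ, ContDiff ℝ 2 φ →
    ∀ x ∈ Ω, ∀ t ∈ Set.Ioi (0:ℝ),
      IsLocalMaxOn (fun q : EuclideanSpace ℝ (Fin N) × ℝ => u q.1 q.2 - φ q)
        (Ω ×ˢ Set.Ioi 0) (x, t) →
      deriv (fun s => φ (x, s)) t ≤
        Fupper p (gradient (fun y => φ (y, t)) x) (hess (fun y => φ (y, t)) x)) ∧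
  (∀ φ : EuclideanSpace ℝ (Fin N) × ℝ → ℝ, ContDiff ℝ 2 φ →
    ∀ x ∈ Ω, ∀ t ∈ Set.Ioi (0:ℝ),
      IsLocalMinOn (fun q : EuclideanSpace ℝ (Fin N) × ℝ => u q.1 q.2 - φ q)
        (Ω ×ˢ Set.Ioi 0) (x, t) →
      Flower p (gradient (fun y => φ (y, t)) x) (hess (fun y => φ (y, t)) x) ≤
        deriv (fun s => φ (x, s)) t)

/-- Bounded (viscosity) solution of problem (P): `u_t = Δ_p^G u` in `Ω × (0,∞)`,
`u = 0` on `Ω × {0}`, `u = 1` on `Γ × (0,∞)`; continuous away from `Γ × {0}`. -/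
def IsSolP {N : ℕ} (p : ℝ) (Ω : Set (EuclideanSpace ℝ (Fin N)))
    (u : EuclideanSpace ℝ (Fin N) → ℝ → ℝ) : Prop :=
  (∃ M : ℝ, ∀ x ∈ closure Ω, ∀ t : ℝ, 0 ≤ t → |u x t| ≤ M) ∧
  (∀ x ∈ closure Ω, ∀ t : ℝ, 0 ≤ t → ¬(x ∈ frontier Ω ∧ t = 0) →
    ContinuousWithinAt (fun q : EuclideanSpace ℝ (Fin N) × ℝ => u q.1 q.2)
      (closure Ω ×ˢ Set.Ici 0) (x, t)) ∧
  IsViscositySol p Ω u ∧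
  (∀ x ∈ Ω, u x 0 = 0) ∧
  (∀ y ∈ frontier Ω, ∀ t : ℝ, 0 < t → u y t = 1)

/-- Viscosity solution of the elliptic equation `u − ε² Δ_p^G u = 0` in `Ω`. -/
def IsEllipticViscositySol {N : ℕ} (p ε : ℝ) (Ω : Set (EuclideanSpace ℝ (Fin N)))
    (u : EuclideanSpace ℝ (Fin N) → ℝ) : Prop :=
  ContinuousOn u Ω ∧
  (∀ φ : EuclideanSpace ℝ (Fin N) → ℝ, ContDiff ℝ 2 φ → ∀ x ∈ Ω,
      IsLocalMaxOn (fun y => u y - φ y) Ω x →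
      φ x - ε^2 * Fupper p (gradient φ x) (hess φ x) ≤ 0) ∧
  (∀ φ : EuclideanSpace ℝ (Fin N) → ℝ, ContDiff ℝ 2 φ → ∀ x ∈ Ω,
      IsLocalMinOn (fun y => u y - φ y) Ω x →
      0 ≤ φ x - ε^2 * Flower p (gradient φ x) (hess φ x))

/-- The complementary error function. -/
noncomputable def Erfc (σ : ℝ) : ℝ := (2 / Real.sqrt π) * ∫ τ in Set.Ioi σ, Real.exp (-τ^2)

/-- The explicit radially symmetric solution `u^ε` of the elliptic problem in the ball `B_R`. -/
noncomputable def uEps (N : ℕ) (p R ε : ℝ) (x : EuclideanSpace ℝ (Fin N)) : ℝ :=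
  (∫ θ in (0:ℝ)..π,
      Real.exp (Real.sqrt (p/(p-1)) * (‖x‖/ε) * Real.cos θ) * (Real.sin θ) ^ (((N:ℝ) - p)/(p-1))) /
  (∫ θ in (0:ℝ)..π,
      Real.exp (Real.sqrt (p/(p-1)) * (R/ε) * Real.cos θ) * (Real.sin θ) ^ (((N:ℝ) - p)/(p-1)))

theorem intervalIntegrable_sin_rpow {a : ℝ} (ha : -1 < a) :
    IntervalIntegrable (fun θ : ℝ => Real.sin θ ^ a) volume 0 π := by
  have h1 : IntervalIntegrable (fun θ : ℝ => θ ^ a) volume 0 π :=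
    intervalIntegral.intervalIntegrable_rpow' ha
  have h2 : IntervalIntegrable (fun θ : ℝ => (π - θ) ^ a) volume 0 π := by
    simpa using (h1.comp_sub_left π).symm
  have hbound : IntervalIntegrable
      (fun θ : ℝ => 1 + ((2 / π) ^ a * θ ^ a + (2 / π) ^ a * (π - θ) ^ a)) volume 0 π :=
    intervalIntegrable_const.add ((h1.const_mul _).add (h2.const_mul _))
  refine hbound.mono_fun' (Real.measurable_sin.pow_const a).aestronglyMeasurable ?_
  have hend : ∀ᵐ θ : ℝ, θ ≠ π := by
    simp [ae_iff]
  rw [uIoc_of_le Real.pi_pos.le]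
  refine (ae_restrict_iff' measurableSet_Ioc).2 ?_
  filter_upwards [hend] with θ hθπ hθ
  have hlt : θ < π := lt_of_le_of_ne hθ.2 hθπ
  have hs : 0 < Real.sin θ := Real.sin_pos_of_pos_of_lt_pi hθ.1 hlt
  have hπ := Real.pi_pos
  rw [Real.norm_of_nonneg (Real.rpow_nonneg hs.le _)]
  have e1 : 0 ≤ (2 / π) ^ a * θ ^ a :=
    mul_nonneg (Real.rpow_nonneg (by positivity) _) (Real.rpow_nonneg hθ.1.le _)
  have e2 : 0 ≤ (2 / π) ^ a * (π - θ) ^ a :=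
    mul_nonneg (Real.rpow_nonneg (by positivity) _) (Real.rpow_nonneg (by linarith) _)
  rcases le_or_gt 0 a with h0 | h0
  · have := Real.rpow_le_one hs.le (Real.sin_le_one θ) h0
    linarith
  rcases le_or_gt θ (π / 2) with hc | hc
  · have h := Real.mul_le_sin hθ.1.le hc
    have := Real.rpow_le_rpow_of_nonpos (mul_pos (by positivity) hθ.1) h h0.le
    rw [Real.mul_rpow (by positivity) hθ.1.le] at this
    linarith
  · have h := Real.mul_le_sin (x := π - θ) (by linarith) (by linarith)
    rw [Real.sin_pi_sub] at h
    have := Real.rpow_le_rpow_of_nonpos (mul_pos (by positivity) (by linarith)) h h0.le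
    rw [Real.mul_rpow (by positivity) (by linarith)] at this
    linarith

/-- The integral `∫₀^π e^{y cos θ} (sin θ)^a dθ`, a modified Bessel function up to normalization. -/
def besselInt (a y : ℝ) : ℝ :=
  ∫ θ in (0 : ℝ)..π, Real.exp (y * Real.cos θ) * Real.sin θ ^ a

theorem intervalIntegrable_mul_sin_rpow {a : ℝ} (ha : -1 < a) {f : ℝ → ℝ} (hf : Continuous f) :
    IntervalIntegrable (fun θ : ℝ => f θ * Real.sin θ ^ a) volume 0 π :=
  (intervalIntegrable_sin_rpow ha).continuousOn_mul hf.continuousOn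

theorem sin_rpow_add_two {a θ : ℝ} (hθ : 0 < Real.sin θ) :
    Real.sin θ ^ (a + 2) = Real.sin θ ^ a * (1 - Real.cos θ ^ 2) := by
  rw [Real.rpow_add hθ, ← Real.sin_sq]
  norm_num

/-- Integration by parts against a power of the sine. -/
theorem integral_deriv_mul_sin_rpow {a : ℝ} (ha : -1 < a) {f f' : ℝ → ℝ}
    (hf : ∀ θ, HasDerivAt f (f' θ) θ) (hf' : Continuous f') :
    (a + 1) * ∫ θ in (0 : ℝ)..π, f θ * Real.cos θ * Real.sin θ ^ a =
      -∫ θ in (0 : ℝ)..π, f' θ * Real.sin θ ^ (a + 1) := by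
  have hfc : Continuous f := continuous_iff_continuousAt.2 fun θ => (hf θ).continuousAt
  have i1 : IntervalIntegrable (fun θ => (a + 1) * (f θ * Real.cos θ * Real.sin θ ^ a))
      volume 0 π :=
    (intervalIntegrable_mul_sin_rpow ha (hfc.mul Real.continuous_cos)).const_mul (a + 1)
  have i2 := intervalIntegrable_mul_sin_rpow (a := a + 1) (by linarith) hf'
  have h := intervalIntegral.integral_eq_sub_of_hasDerivAt_of_le (a := 0) (b := π)
    (f := fun θ => f θ * Real.sin θ ^ (a + 1))
    (f' := fun θ => (a + 1) * (f θ * Real.cos θ * Real.sin θ ^ a) + f' θ * Real.sin θ ^ (a + 1))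
    Real.pi_pos.le
    (hfc.mul (Real.continuous_sin.rpow_const fun _ => Or.inr (by linarith))).continuousOn ?_
    (i1.add i2)
  · rw [intervalIntegral.integral_add i1 i2, intervalIntegral.integral_const_mul] at h
    simp [Real.zero_rpow (by linarith : a + 1 ≠ 0)] at h
    linarith
  · intro θ hθ
    have hs := Real.sin_pos_of_pos_of_lt_pi hθ.1 hθ.2
    refine ((hf θ).mul
      ((Real.hasDerivAt_sin θ).rpow_const (p := a + 1) (Or.inl hs.ne'))).congr_deriv ?_
    rw [add_sub_cancel_right]
    ring

theorem hasDerivAt_besselInt {a : ℝ} (ha : -1 < a) (y : ℝ) :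
    HasDerivAt (besselInt a) (y / (a + 1) * besselInt (a + 2) y) y := by
  have key := intervalIntegral.hasDerivAt_integral_of_dominated_loc_of_deriv_le
    (μ := volume) (a := 0) (b := π) (x₀ := y) (s := ball y 1)
    (F := fun y θ => Real.exp (y * Real.cos θ) * Real.sin θ ^ a)
    (F' := fun y θ => Real.exp (y * Real.cos θ) * Real.cos θ * Real.sin θ ^ a)
    (bound := fun θ => Real.exp (|y| + 1) * |Real.sin θ ^ a|)
    (ball_mem_nhds y one_pos)
    (Eventually.of_forall fun z =>
      (intervalIntegrable_mul_sin_rpow ha (by fun_prop)).def'.aestronglyMeasurable)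
    (intervalIntegrable_mul_sin_rpow ha (by fun_prop))
    (intervalIntegrable_mul_sin_rpow ha (by fun_prop)).def'.aestronglyMeasurable
    (Eventually.of_forall fun θ _ z hz => by
      rw [norm_mul, norm_mul, Real.norm_eq_abs, Real.norm_eq_abs, Real.norm_eq_abs, Real.abs_exp]
      refine mul_le_mul_of_nonneg_right ?_ (abs_nonneg _)
      have h1 : |z| ≤ |y| + 1 := by
        have h2 : |z - y| < 1 := hz
        have h3 := abs_sub_abs_le_abs_sub z y
        linarith
      have h2 : z * Real.cos θ ≤ |y| + 1 :=
        (le_abs_self _).trans ((abs_mul _ _).trans_le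
          ((mul_le_of_le_one_right (abs_nonneg _) (Real.abs_cos_le_one θ)).trans h1))
      calc Real.exp (z * Real.cos θ) * |Real.cos θ| ≤ Real.exp (z * Real.cos θ) * 1 :=
            mul_le_mul_of_nonneg_left (Real.abs_cos_le_one θ) (Real.exp_pos _).le
        _ ≤ Real.exp (|y| + 1) := by rw [mul_one]; exact Real.exp_le_exp.2 h2)
    ((intervalIntegrable_sin_rpow ha).abs.const_mul _)
    (Eventually.of_forall fun θ _ z _ => by
      have := ((hasDerivAt_id z).mul_const (Real.cos θ)).exp.mul_const (Real.sin θ ^ a)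
      simpa using this)
  refine key.2.congr_deriv ?_
  have h := integral_deriv_mul_sin_rpow ha (f := fun θ => Real.exp (y * Real.cos θ))
    (f' := fun θ => Real.exp (y * Real.cos θ) * (y * -Real.sin θ))
    (fun θ => ((Real.hasDerivAt_cos θ).const_mul y).exp) (by fun_prop)
  have e : ∫ θ in (0 : ℝ)..π, Real.exp (y * Real.cos θ) * (y * -Real.sin θ) * Real.sin θ ^ (a + 1)
      = -y * besselInt (a + 2) y := by
    rw [besselInt, ← intervalIntegral.integral_const_mul]
    refine intervalIntegral.integral_congr fun θ hθ => ?_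
    rw [uIcc_of_le Real.pi_pos.le] at hθ
    have hs := Real.sin_nonneg_of_mem_Icc hθ
    have : Real.sin θ ^ (a + 2) = Real.sin θ ^ (a + 1) * Real.sin θ := by
      rw [← Real.rpow_add_one' hs (by linarith)]
      ring_nf
    simp only [this]
    ring
  rw [e] at h
  rw [div_mul_eq_mul_div, eq_div_iff (by linarith : a + 1 ≠ 0), mul_comm, h]
  ring

/-- The three-term recurrence equivalent to Bessel's differential equation. -/
theorem besselInt_recurrence {a : ℝ} (ha : -1 < a) (y : ℝ) :
    (a + 1) * besselInt a y =
      (a + 2) * besselInt (a + 2) y + y ^ 2 / (a + 3) * besselInt (a + 4) y := by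
  have hc : ∀ θ, HasDerivAt (fun θ => Real.exp (y * Real.cos θ))
      (Real.exp (y * Real.cos θ) * (y * -Real.sin θ)) θ :=
    fun θ => ((Real.hasDerivAt_cos θ).const_mul y).exp
  have h1 := integral_deriv_mul_sin_rpow ha
    (f := fun θ => Real.exp (y * Real.cos θ) * Real.cos θ)
    (f' := fun θ => Real.exp (y * Real.cos θ) * (y * -Real.sin θ) * Real.cos θ +
      Real.exp (y * Real.cos θ) * -Real.sin θ)
    (fun θ => (hc θ).mul (Real.hasDerivAt_cos θ)) (by fun_prop)
  have h2 := integral_deriv_mul_sin_rpow (a := a + 2) (by linarith)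
    (f := fun θ => Real.exp (y * Real.cos θ))
    (f' := fun θ => Real.exp (y * Real.cos θ) * (y * -Real.sin θ)) hc (by fun_prop)
  have ie : Continuous fun θ => Real.exp (y * Real.cos θ) := by fun_prop
  have e1 : ∫ θ in (0 : ℝ)..π, Real.exp (y * Real.cos θ) * Real.cos θ * Real.cos θ * Real.sin θ ^ a
      = besselInt a y - besselInt (a + 2) y := by
    rw [besselInt, besselInt, ← intervalIntegral.integral_sub
      (intervalIntegrable_mul_sin_rpow ha ie)
      (intervalIntegrable_mul_sin_rpow (by linarith) ie)]
    refine intervalIntegral.integral_congr_ae ?_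
    have hend : ∀ᵐ θ : ℝ, θ ≠ π := by simp [ae_iff]
    filter_upwards [hend] with θ hθπ hθ
    rw [uIoc_of_le Real.pi_pos.le] at hθ
    rw [sin_rpow_add_two (Real.sin_pos_of_pos_of_lt_pi hθ.1 (lt_of_le_of_ne hθ.2 hθπ))]
    ring
  have hpow : ∀ b : ℝ, -1 < b → ∀ θ ∈ uIcc 0 π,
      Real.sin θ ^ (b + 1) * Real.sin θ = Real.sin θ ^ (b + 2) := by
    intro b hb θ hθ
    rw [uIcc_of_le Real.pi_pos.le] at hθ
    rw [← Real.rpow_add_one' (Real.sin_nonneg_of_mem_Icc hθ) (by linarith)]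
    ring_nf
  have i3 : IntervalIntegrable (fun θ => -(y * (Real.exp (y * Real.cos θ) * Real.cos θ *
      Real.sin θ ^ (a + 2)))) volume 0 π :=
    ((intervalIntegrable_mul_sin_rpow (by linarith) (by fun_prop)).const_mul y).neg
  have e2 : ∫ θ in (0 : ℝ)..π, (Real.exp (y * Real.cos θ) * (y * -Real.sin θ) * Real.cos θ +
      Real.exp (y * Real.cos θ) * -Real.sin θ) * Real.sin θ ^ (a + 1) =
      -(y * ∫ θ in (0 : ℝ)..π, Real.exp (y * Real.cos θ) * Real.cos θ * Real.sin θ ^ (a + 2))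
        - besselInt (a + 2) y := by
    rw [besselInt, ← intervalIntegral.integral_const_mul, ← intervalIntegral.integral_neg,
      ← intervalIntegral.integral_sub i3
      (intervalIntegrable_mul_sin_rpow (a := a + 2) (by linarith) ie)]
    refine intervalIntegral.integral_congr fun θ hθ => ?_
    simp only [← hpow a ha θ hθ]
    ring
  have e3 : ∫ θ in (0 : ℝ)..π, Real.exp (y * Real.cos θ) * (y * -Real.sin θ) *
      Real.sin θ ^ (a + 2 + 1) = -y * besselInt (a + 4) y := by
    rw [besselInt, ← intervalIntegral.integral_const_mul]
    refine intervalIntegral.integral_congr fun θ hθ => ?_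
    have := hpow (a + 2) (by linarith) θ hθ
    rw [show a + 2 + 2 = a + 4 by ring] at this
    simp only [← this]
    ring
  rw [e1, e2] at h1
  rw [e3] at h2
  have h3 : ∫ θ in (0 : ℝ)..π, Real.exp (y * Real.cos θ) * Real.cos θ * Real.sin θ ^ (a + 2) =
      y / (a + 3) * besselInt (a + 4) y := by
    rw [div_mul_eq_mul_div, eq_div_iff (by linarith : a + 3 ≠ 0)]
    linarith
  rw [h3] at h1
  have h4 : y ^ 2 / (a + 3) * besselInt (a + 4) y
      = y * (y / (a + 3) * besselInt (a + 4) y) := by ring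
  rw [h4]
  linarith

theorem besselInt_pos {a : ℝ} (ha : -1 < a) (y : ℝ) : 0 < besselInt a y :=
  intervalIntegral.intervalIntegral_pos_of_pos_on
    (intervalIntegrable_mul_sin_rpow ha (by fun_prop))
    (fun _ hθ => mul_pos (Real.exp_pos _)
      (Real.rpow_pos_of_pos (Real.sin_pos_of_pos_of_lt_pi hθ.1 hθ.2) _)) Real.pi_pos

theorem nonpos_of_isLocalMax_of_hasDerivAt {h h' : ℝ → ℝ} {c x₀ : ℝ}
    (hh : ∀ x, HasDerivAt h (h' x) x) (hh' : HasDerivAt h' c x₀) (hmax : IsLocalMax h x₀) :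
    h' x₀ = 0 ∧ c ≤ 0 := by
  have e : deriv h = h' := funext fun x => (hh x).deriv
  have h0 : h' x₀ = 0 := by
    rw [← e]
    exact hmax.deriv_eq_zero
  refine ⟨h0, ?_⟩
  by_contra! hc
  have hmin : IsLocalMin h x₀ := by
    refine isLocalMin_of_deriv_deriv_pos ?_ (by rw [e, h0]) (hh x₀).continuousAt
    rw [e, hh'.deriv]
    exact hc
  have hconst : h =ᶠ[𝓝 x₀] fun _ => h x₀ := by
    filter_upwards [hmin, hmax] with y h1 h2 using le_antisymm h2 h1
  have hd : h' =ᶠ[𝓝 x₀] fun _ => 0 := by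
    have := hconst.deriv
    rw [e] at this
    simpa using this
  have := (hh'.congr_of_eventuallyEq hd.symm).unique (hasDerivAt_const x₀ (0 : ℝ))
  linarith

section Radial

variable {V : Type*} [NormedAddCommGroup V]

/-- The radial function `x ↦ ∫₀^π e^{κ|x| cos θ} (sin θ)^a dθ`. -/
def radialBessel (a κ : ℝ) (x : V) : ℝ := besselInt a (κ * ‖x‖)

/-- Finite linear combinations of radial Bessel functions. -/
def radialSum (s : Finset ℕ) (κ : ℕ → ℝ) (a : ℝ) (b : ℕ → ℝ) (x : V) : ℝ :=
  ∑ k ∈ s, b k * radialBessel a (κ k) x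

variable (s : Finset ℕ) (κ : ℕ → ℝ)

theorem radialSum_recurrence {a : ℝ} (ha : -1 < a) (b : ℕ → ℝ) (x : V) :
    (a + 2) * radialSum s κ (a + 2) (fun k => b k * κ k ^ 2 / (a + 1)) x +
      radialSum s κ (a + 2 + 2)
        (fun k => b k * κ k ^ 2 / (a + 1) * κ k ^ 2 / (a + 2 + 1)) x * ‖x‖ ^ 2 =
      radialSum s κ a (fun k => b k * κ k ^ 2) x := by
  simp only [radialSum, Finset.mul_sum, Finset.sum_mul, ← Finset.sum_add_distrib]
  refine Finset.sum_congr rfl fun k _ => ?_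
  have h := besselInt_recurrence ha (κ k * ‖x‖)
  have h1 : a + 1 ≠ 0 := by linarith
  have h3 : a + 3 ≠ 0 := by linarith
  rw [show a + 2 + 2 = a + 4 by ring, show a + 2 + 1 = a + 3 by ring]
  simp only [radialBessel]
  have h' : besselInt a (κ k * ‖x‖) = ((a + 2) * besselInt (a + 2) (κ k * ‖x‖) +
      (κ k * ‖x‖) ^ 2 / (a + 3) * besselInt (a + 4) (κ k * ‖x‖)) / (a + 1) := by
    rw [← h]
    field_simp
  rw [h']
  field_simp

variable [InnerProductSpace ℝ V]

theorem hasFDerivAt_radialBessel {a : ℝ} (ha : -1 < a) (κ : ℝ) (x : V) :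
    HasFDerivAt (radialBessel a κ)
      ((κ ^ 2 / (a + 1) * radialBessel (a + 2) κ x) • innerSL ℝ x) x := by
  rcases eq_or_ne x 0 with rfl | hx
  · have h0 : HasDerivAt (besselInt a) 0 0 := by
      simpa using hasDerivAt_besselInt ha 0
    have hlim : Tendsto (fun y : V => κ * ‖y‖) (𝓝 0) (𝓝 0) := by
      have : Continuous fun y : V => κ * ‖y‖ := by fun_prop
      simpa using this.tendsto 0
    have hO : (fun y : V => κ * ‖y‖) =O[𝓝 0] fun y => y :=
      Asymptotics.IsBigO.of_bound |κ| (Eventually.of_forall fun y => by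
        simp)
    have hlo := (hasDerivAt_iff_isLittleO.1 h0).comp_tendsto hlim
    simp only [Function.comp_def, sub_zero, smul_zero] at hlo
    rw [hasFDerivAt_iff_isLittleO]
    simpa [radialBessel] using hlo.trans_isBigO hO
  · have hn : ‖x‖ ≠ 0 := norm_ne_zero_iff.2 hx
    have h1 : HasFDerivAt (fun y : V => ‖y‖) (‖x‖⁻¹ • innerSL ℝ x) x := by
      have h2 := (hasStrictFDerivAt_norm_sq x).hasFDerivAt.sqrt (pow_ne_zero 2 hn)
      simp only [Real.sqrt_sq (norm_nonneg _)] at h2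
      refine h2.congr_fderiv ?_
      ext v
      simp
      field_simp
    refine ((hasDerivAt_besselInt ha (κ * ‖x‖)).comp_hasFDerivAt x
      (h1.const_mul κ)).congr_fderiv ?_
    ext v
    simp [radialBessel]
    field_simp

theorem contDiff_radialBessel {a : ℝ} (ha : -1 < a) (κ : ℝ) (n : ℕ) :
    ContDiff ℝ n (radialBessel a κ : V → ℝ) := by
  induction n generalizing a with
  | zero =>
    exact contDiff_zero.2 (continuous_iff_continuousAt.2 fun x =>
      (hasFDerivAt_radialBessel ha κ x).continuousAt)
  | succ n ih =>
    rw [Nat.cast_succ, contDiff_succ_iff_hasFDerivAt]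
    refine ⟨_, ?_, hasFDerivAt_radialBessel ha κ⟩
    have := ih (a := a + 2) (by linarith)
    exact (contDiff_const.mul this).smul (innerSL ℝ).contDiff

theorem hasFDerivAt_radialSum {a : ℝ} (ha : -1 < a) (b : ℕ → ℝ) (x : V) :
    HasFDerivAt (radialSum s κ a b)
      (radialSum s κ (a + 2) (fun k => b k * κ k ^ 2 / (a + 1)) x • innerSL ℝ x) x := by
  refine (HasFDerivAt.fun_sum fun k _ =>
    (hasFDerivAt_radialBessel ha (κ k) x).const_mul (b k)).congr_fderiv ?_
  rw [radialSum, Finset.sum_smul]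
  refine Finset.sum_congr rfl fun k _ => ?_
  rw [smul_smul]
  congr 1
  ring

/-- At a local maximum, up to a quartic error, a radial sum has nonpositive normalized
`p`-Laplacian. -/
theorem radialSum_mul_sq_nonpos [Nontrivial V] {a : ℝ} (ha : -1 < a) (b : ℕ → ℝ) {x : V} {C : ℝ}
    (hmax : ∀ᶠ y in 𝓝 x, radialSum s κ a b y ≤ radialSum s κ a b x + C * ‖y - x‖ ^ 4) :
    radialSum s κ a (fun k => b k * κ k ^ 2) x ≤ 0 := by
  set A : V → ℝ := radialSum s κ (a + 2) (fun k => b k * κ k ^ 2 / (a + 1)) with hA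
  set B : V → ℝ := radialSum s κ (a + 2 + 2)
    (fun k => b k * κ k ^ 2 / (a + 1) * κ k ^ 2 / (a + 2 + 1)) with hB
  have dir : ∀ e : V, A x * inner ℝ x e = 0 ∧ A x * ‖e‖ ^ 2 + B x * inner ℝ x e ^ 2 ≤ 0 := by
    intro e
    have hline : ∀ r : ℝ, HasDerivAt (fun r : ℝ => x + r • e) e r := fun r => by
      simpa using ((hasDerivAt_id r).smul_const e).const_add x
    have d1 : ∀ r : ℝ, HasDerivAt
        (fun r : ℝ => radialSum s κ a b (x + r • e) - C * ‖e‖ ^ 4 * r ^ 4)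
        (A (x + r • e) * inner ℝ (x + r • e) e - C * ‖e‖ ^ 4 * (4 * r ^ 3)) r := by
      intro r
      have h1 := (hasFDerivAt_radialSum s κ ha b (x + r • e)).comp_hasDerivAt r (hline r)
      have h2 := (hasDerivAt_pow 4 r).const_mul (C * ‖e‖ ^ 4)
      refine (h1.sub h2).congr_deriv ?_
      simp [hA, inner_add_left, inner_smul_left]
      ring
    have d2 : HasDerivAt
        (fun r : ℝ => A (x + r • e) * inner ℝ (x + r • e) e - C * ‖e‖ ^ 4 * (4 * r ^ 3))
        (A x * ‖e‖ ^ 2 + B x * inner ℝ x e ^ 2) 0 := by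
      have h1 := (hasFDerivAt_radialSum s κ (a := a + 2) (by linarith)
        (fun k => b k * κ k ^ 2 / (a + 1)) (x + (0 : ℝ) • e)).comp_hasDerivAt 0 (hline 0)
      have h3 : HasDerivAt (fun r : ℝ => inner ℝ (x + r • e) e) (inner ℝ e e) 0 := by
        simpa using (hline 0).inner ℝ (hasDerivAt_const (0 : ℝ) e)
      have h2 := ((hasDerivAt_pow 3 (0 : ℝ)).const_mul 4).const_mul (C * ‖e‖ ^ 4)
      refine ((h1.mul h3).sub h2).congr_deriv ?_
      simp [hA, hB]
      ring
    have hm : IsLocalMax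
        (fun r : ℝ => radialSum s κ a b (x + r • e) - C * ‖e‖ ^ 4 * r ^ 4) 0 := by
      have ht : Tendsto (fun r : ℝ => x + r • e) (𝓝 0) (𝓝 x) := by
        simpa using (hline 0).continuousAt.tendsto
      filter_upwards [ht.eventually hmax] with r hr
      have hq : ‖r • e‖ ^ 4 = ‖e‖ ^ 4 * r ^ 4 := by
        rw [norm_smul, mul_pow, Real.norm_eq_abs, Even.pow_abs ⟨2, rfl⟩]
        ring
      simp only [add_sub_cancel_left, hq] at hr
      simp
      linarith
    obtain ⟨h0, hc⟩ := nonpos_of_isLocalMax_of_hasDerivAt d1 d2 hm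
    refine ⟨by simpa using h0, hc⟩
  rw [← radialSum_recurrence s κ ha b x]
  change (a + 2) * A x + B x * ‖x‖ ^ 2 ≤ 0
  rcases eq_or_ne x 0 with hx | hx
  · obtain ⟨e, he⟩ := exists_ne (0 : V)
    have h := (dir e).2
    have he' : 0 < ‖e‖ ^ 2 := by positivity
    have hA0 : A x ≤ 0 := by
      have : A x * ‖e‖ ^ 2 ≤ 0 := by simpa [hx] using h
      exact nonpos_of_mul_nonpos_left this he'
    simp only [hx, norm_zero] at hA0 ⊢
    nlinarith
  · have hx' : 0 < ‖x‖ ^ 2 := by positivity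
    obtain ⟨h1, h2⟩ := dir x
    rw [real_inner_self_eq_norm_sq] at h1 h2
    have hA0 : A x = 0 := by
      rcases mul_eq_zero.1 h1 with h | h
      · exact h
      · exact absurd h hx'.ne'
    rw [hA0] at h2 ⊢
    have : B x * ‖x‖ ^ 2 ≤ 0 := by
      have : B x * ‖x‖ ^ 2 * ‖x‖ ^ 2 ≤ 0 := by nlinarith
      exact nonpos_of_mul_nonpos_left this hx'
    linarith

end Radial

section Jets

variable {N : ℕ}

theorem gradient_comp_sub (f : EuclideanSpace ℝ (Fin N) → ℝ) (z x : EuclideanSpace ℝ (Fin N)) :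
    gradient (fun y => f (y - z)) x = gradient f (x - z) := by
  rw [gradient, gradient, fderiv_comp_sub]

theorem hess_comp_sub (f : EuclideanSpace ℝ (Fin N) → ℝ) (z x : EuclideanSpace ℝ (Fin N)) :
    hess (fun y => f (y - z)) x = hess f (x - z) := by
  ext i j
  rw [hess, hess, iteratedFDeriv_comp_sub]

theorem gradient_eq_smul {f A : EuclideanSpace ℝ (Fin N) → ℝ} {x : EuclideanSpace ℝ (Fin N)}
    (hf : HasFDerivAt f (A x • innerSL ℝ x) x) : gradient f x = A x • x := by
  rw [gradient, hf.fderiv, LinearIsometryEquiv.symm_apply_eq]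
  ext v
  simp

theorem hess_eq_of_hasFDerivAt {f A : EuclideanSpace ℝ (Fin N) → ℝ} {B : ℝ}
    {x : EuclideanSpace ℝ (Fin N)} (hf : ∀ y, HasFDerivAt f (A y • innerSL ℝ y) y)
    (hA : HasFDerivAt A (B • innerSL ℝ x) x) :
    hess f x = A x • (1 : Matrix (Fin N) (Fin N) ℝ) + B • Matrix.of fun i j => x i * x j := by
  have h1 : fderiv ℝ f = A • fun y => innerSL ℝ y := funext fun y => (hf y).fderiv
  have h2 := hA.smul (innerSL ℝ (E := EuclideanSpace ℝ (Fin N))).hasFDerivAt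
  ext i j
  rw [hess, iteratedFDeriv_two_apply, h1, h2.fderiv]
  change A x * inner ℝ (EuclideanSpace.single i (1 : ℝ)) (EuclideanSpace.single j 1) +
    B * inner ℝ x (EuclideanSpace.single i (1 : ℝ)) * inner ℝ x (EuclideanSpace.single j 1) = _
  simp only [EuclideanSpace.inner_single_right]
  rcases eq_or_ne i j with h | h
  · simp [h]
    ring
  · simp [h, h.symm]
    ring

theorem Fop_of_hess_eq {p A B : ℝ} {x : EuclideanSpace ℝ (Fin N)} (hx : A • x ≠ 0) :
    Fop p (A • x) (A • (1 : Matrix (Fin N) (Fin N) ℝ) + B • Matrix.of fun i j => x i * x j) =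
      1 / p * ((N + p - 2) * A + (p - 1) * (B * ‖x‖ ^ 2)) := by
  have hsq : ∑ i, x i * x i = ‖x‖ ^ 2 := by
    rw [EuclideanSpace.norm_sq_eq]
    simp [← sq]
  have htr : Matrix.trace (A • (1 : Matrix (Fin N) (Fin N) ℝ) +
      B • Matrix.of fun i j => x i * x j) = N * A + B * ‖x‖ ^ 2 := by
    rw [Matrix.trace_add, Matrix.trace_smul, Matrix.trace_smul, Matrix.trace_one, Matrix.trace]
    simp [hsq, mul_comm]
  have hq : qform (A • (1 : Matrix (Fin N) (Fin N) ℝ) + B • Matrix.of fun i j => x i * x j)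
      (A • x) = (A + B * ‖x‖ ^ 2) * ‖A • x‖ ^ 2 := by
    have e : ∀ i j, (A • (1 : Matrix (Fin N) (Fin N) ℝ) + B • Matrix.of fun i j => x i * x j) i j *
        (A • x) j * (A • x) i = (if i = j then A ^ 3 * (x i * x i) else 0) +
          (B * A ^ 2) * ((x i * x i) * (x j * x j)) := by
      intro i j
      rcases eq_or_ne i j with h | h
      · simp [h]
        ring
      · simp [h]
        ring
    simp only [qform, e, Finset.sum_add_distrib, Finset.sum_ite_eq, Finset.mem_univ, if_true,
      ← Finset.mul_sum, ← Finset.sum_mul, hsq]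
    rw [norm_smul, mul_pow, Real.norm_eq_abs, sq_abs]
    ring
  have hn : ‖A • x‖ ^ 2 ≠ 0 := pow_ne_zero 2 (norm_ne_zero_iff.2 hx)
  rw [Fop, htr, hq, ← mul_assoc, mul_div_assoc, div_self hn]
  ring

theorem hasFDerivAt_norm_pow_four (C : ℝ) (x : EuclideanSpace ℝ (Fin N)) :
    HasFDerivAt (fun y : EuclideanSpace ℝ (Fin N) => C * ‖y‖ ^ 4)
      ((4 * C * ‖x‖ ^ 2) • innerSL ℝ x) x := by
  have h := (((hasStrictFDerivAt_norm_sq x).hasFDerivAt).pow 2).const_mul C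
  simp only [← pow_mul] at h
  refine h.congr_fderiv ?_
  ext v
  simp
  ring

theorem gradient_norm_sub_pow_four (C c : ℝ) (x : EuclideanSpace ℝ (Fin N)) :
    gradient (fun y => c + C * ‖y - x‖ ^ 4) x = 0 := by
  rw [gradient_comp_sub (fun y => c + C * ‖y‖ ^ 4), sub_self,
    gradient_eq_smul (A := fun y => 4 * C * ‖y‖ ^ 2) ((hasFDerivAt_norm_pow_four C 0).const_add c)]
  simp

theorem hess_norm_sub_pow_four (C c : ℝ) (x : EuclideanSpace ℝ (Fin N)) :
    hess (fun y => c + C * ‖y - x‖ ^ 4) x = 0 := by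
  rw [hess_comp_sub (fun y => c + C * ‖y‖ ^ 4), sub_self,
    hess_eq_of_hasFDerivAt (A := fun y => 4 * C * ‖y‖ ^ 2) (B := 0)
      (fun y => (hasFDerivAt_norm_pow_four C y).const_add c) ?_]
  · simp
  · refine ((hasStrictFDerivAt_norm_sq (0 : EuclideanSpace ℝ (Fin N))).hasFDerivAt.const_mul
      (4 * C)).congr_fderiv ?_
    simp

theorem qform_zero (v : EuclideanSpace ℝ (Fin N)) : qform 0 v = 0 := by
  simp [qform]

theorem lamMin_zero [NeZero N] : lamMin (0 : Matrix (Fin N) (Fin N) ℝ) = 0 := by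
  have : {r : ℝ | ∃ v : EuclideanSpace ℝ (Fin N), ‖v‖ = 1 ∧ r = qform 0 v} = {0} := by
    ext r
    simp only [qform_zero, mem_ofPred_eq, mem_singleton_iff]
    exact ⟨fun ⟨_, _, h⟩ => h, fun h => ⟨EuclideanSpace.single 0 1, by simp, h⟩⟩
  rw [lamMin, this, csInf_singleton]

theorem lamMax_zero [NeZero N] : lamMax (0 : Matrix (Fin N) (Fin N) ℝ) = 0 := by
  have : {r : ℝ | ∃ v : EuclideanSpace ℝ (Fin N), ‖v‖ = 1 ∧ r = qform 0 v} = {0} := by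
    ext r
    simp only [qform_zero, mem_ofPred_eq, mem_singleton_iff]
    exact ⟨fun ⟨_, _, h⟩ => h, fun h => ⟨EuclideanSpace.single 0 1, by simp, h⟩⟩
  rw [lamMax, this, csSup_singleton]

theorem gradient_neg' (f : EuclideanSpace ℝ (Fin N) → ℝ) (x : EuclideanSpace ℝ (Fin N)) :
    gradient (fun y => -f y) x = -gradient f x := by
  rw [gradient, gradient, fderiv_fun_neg, map_neg]

theorem hess_neg (f : EuclideanSpace ℝ (Fin N) → ℝ) (x : EuclideanSpace ℝ (Fin N)) :
    hess (fun y => -f y) x = -hess f x := by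
  ext i j
  have : (fun y => -f y) = -f := rfl
  rw [Matrix.neg_apply, hess, hess, this, iteratedFDeriv_neg]
  rfl

theorem Fop_neg (p : ℝ) (ξ : EuclideanSpace ℝ (Fin N)) (X : Matrix (Fin N) (Fin N) ℝ) :
    Fop p (-ξ) (-X) = -Fop p ξ X := by
  have : qform (-X) (-ξ) = -qform X ξ := by
    simp [qform]
  rw [Fop, Fop, this, norm_neg, Matrix.trace_neg]
  ring

end Jets

/-- Viscosity subsolutions of `u_t = Δ_p^G u`, tested only where the spatial gradient is nonzero or
the spatial gradient and Hessian both vanish. -/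
def IsViscositySubsol {N : ℕ} (p : ℝ) (Ω : Set (EuclideanSpace ℝ (Fin N)))
    (u : EuclideanSpace ℝ (Fin N) → ℝ → ℝ) : Prop :=
  ∀ φ : EuclideanSpace ℝ (Fin N) × ℝ → ℝ, ContDiff ℝ 2 φ →
    ∀ x ∈ Ω, ∀ t ∈ Set.Ioi (0 : ℝ),
      IsLocalMaxOn (fun q : EuclideanSpace ℝ (Fin N) × ℝ => u q.1 q.2 - φ q)
        (Ω ×ˢ Set.Ioi 0) (x, t) →
      (gradient (fun y => φ (y, t)) x ≠ 0 → deriv (fun s => φ (x, s)) t ≤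
        Fop p (gradient (fun y => φ (y, t)) x) (hess (fun y => φ (y, t)) x)) ∧
      (gradient (fun y => φ (y, t)) x = 0 → hess (fun y => φ (y, t)) x = 0 →
        deriv (fun s => φ (x, s)) t ≤ 0)

theorem IsViscositySol.isViscositySubsol {N : ℕ} [NeZero N] {p : ℝ}
    {Ω : Set (EuclideanSpace ℝ (Fin N))} {u : EuclideanSpace ℝ (Fin N) → ℝ → ℝ}
    (hu : IsViscositySol p Ω u) : IsViscositySubsol p Ω u := by
  intro φ hφ x hx t ht hmax
  have h := hu.2.1 φ hφ x hx t ht hmax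
  refine ⟨fun hg => ?_, fun hg hh => ?_⟩
  · rwa [Fupper, if_neg hg] at h
  · rw [Fupper, if_pos hg, hh, lamMin_zero, lamMax_zero] at h
    simpa using h

theorem IsViscositySol.isViscositySubsol_neg {N : ℕ} [NeZero N] {p : ℝ}
    {Ω : Set (EuclideanSpace ℝ (Fin N))} {u : EuclideanSpace ℝ (Fin N) → ℝ → ℝ}
    (hu : IsViscositySol p Ω u) : IsViscositySubsol p Ω (fun x t => -u x t) := by
  intro φ hφ x hx t ht hmax
  have h := hu.2.2 (fun q => -φ q) hφ.neg x hx t ht (by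
    have := hmax.neg
    refine this.congr (Eventually.of_forall fun q => ?_) ⟨hx, ht⟩
    simp
    ring)
  rw [gradient_neg' (fun y => φ (y, t)), hess_neg (fun y => φ (y, t)), deriv.fun_neg] at h
  refine ⟨fun hg => ?_, fun hg hh => ?_⟩
  · rw [Flower, if_neg (neg_ne_zero.2 hg), Fop_neg] at h
    exact neg_le_neg_iff.1 h
  · rw [Flower, if_pos (neg_eq_zero.2 hg), hh, neg_zero, lamMin_zero, lamMax_zero] at h
    simpa using h

section Comparison

variable {N : ℕ}

theorem exists_interior_max_of_doubling {R t₀ t₁ m : ℝ} {w : EuclideanSpace ℝ (Fin N) → ℝ → ℝ}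
    {φ : EuclideanSpace ℝ (Fin N) × ℝ → ℝ} (hφ : Continuous φ)
    (hcont : ContinuousOn (fun q : EuclideanSpace ℝ (Fin N) × ℝ => w q.1 q.2)
      (closedBall 0 R ×ˢ Icc t₀ t₁))
    (hb : ∀ x ∈ closedBall 0 R, ∀ t ∈ Icc t₀ t₁,
      (x ∈ sphere 0 R ∨ t = t₀ ∨ t = t₁) → w x t ≤ φ (x, t))
    (hm : 0 < m) (hex : ∃ x ∈ closedBall 0 R, ∃ t ∈ Icc t₀ t₁, m ≤ w x t - φ (x, t)) :
    ∃ n : ℕ, 0 < n ∧ ∃ x ∈ ball 0 R, ∃ y ∈ ball 0 R, ∃ t ∈ Ioo t₀ t₁,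
      ∀ x' ∈ ball 0 R, ∀ y' ∈ ball 0 R, ∀ t' ∈ Ioo t₀ t₁,
        w x' t' - φ (y', t') - n * ‖y' - x'‖ ^ 4 ≤ w x t - φ (y, t) - n * ‖y - x‖ ^ 4 := by
  obtain ⟨x₀, hx₀, s₀, hs₀, hm₀⟩ := hex
  set K : Set (EuclideanSpace ℝ (Fin N) × EuclideanSpace ℝ (Fin N) × ℝ) :=
    closedBall 0 R ×ˢ closedBall 0 R ×ˢ Icc t₀ t₁ with hK
  have hKc : IsCompact K :=
    (isCompact_closedBall _ _).prod ((isCompact_closedBall _ _).prod isCompact_Icc)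
  have hw : ContinuousOn (fun q : EuclideanSpace ℝ (Fin N) × EuclideanSpace ℝ (Fin N) × ℝ =>
      w q.1 q.2.2 - φ (q.2.1, q.2.2)) K := by
    refine ContinuousOn.sub ?_ (by fun_prop)
    exact hcont.comp (f := fun q : EuclideanSpace ℝ (Fin N) × EuclideanSpace ℝ (Fin N) × ℝ =>
      (q.1, q.2.2)) (by fun_prop) fun q hq => ⟨hq.1, hq.2.2⟩
  have hmax : ∀ n : ℕ, ∃ q ∈ K, ∀ q' ∈ K,
      w q'.1 q'.2.2 - φ (q'.2.1, q'.2.2) - n * ‖q'.2.1 - q'.1‖ ^ 4 ≤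
        w q.1 q.2.2 - φ (q.2.1, q.2.2) - n * ‖q.2.1 - q.1‖ ^ 4 := fun n =>
    hKc.exists_isMaxOn ⟨(x₀, x₀, s₀), hx₀, hx₀, hs₀⟩ (hw.sub (by fun_prop))
  choose q hqK hq using hmax
  have hqm : ∀ n : ℕ, m + n * ‖(q n).2.1 - (q n).1‖ ^ 4 ≤
      w (q n).1 (q n).2.2 - φ ((q n).2.1, (q n).2.2) := by
    intro n
    have := hq n (x₀, x₀, s₀) ⟨hx₀, hx₀, hs₀⟩
    simp only [sub_self, norm_zero] at this
    linarith
  obtain ⟨⟨x, y, t⟩, hlim, g, hg, hgt⟩ := hKc.tendsto_subseq hqK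
  have hgw : Tendsto (fun n => w (q (g n)).1 (q (g n)).2.2 -
      φ ((q (g n)).2.1, (q (g n)).2.2)) atTop (𝓝 (w x t - φ (y, t))) :=
    (hw (x, y, t) hlim).tendsto.comp (tendsto_nhdsWithin_iff.2 ⟨hgt, Eventually.of_forall
      fun n => hqK (g n)⟩)
  have hx : Tendsto (fun n => (q (g n)).1) atTop (𝓝 x) := (continuous_fst.tendsto _).comp hgt
  have hy : Tendsto (fun n => (q (g n)).2.1) atTop (𝓝 y) :=
    ((continuous_fst.comp continuous_snd).tendsto _).comp hgt
  have ht : Tendsto (fun n => (q (g n)).2.2) atTop (𝓝 t) :=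
    ((continuous_snd.comp continuous_snd).tendsto _).comp hgt
  have hmle : m ≤ w x t - φ (y, t) := by
    refine ge_of_tendsto' hgw fun n => le_trans ?_ (hqm (g n))
    have : (0 : ℝ) ≤ (g n : ℝ) * ‖(q (g n)).2.1 - (q (g n)).1‖ ^ 4 := by positivity
    linarith
  have hgn : Tendsto (fun n => (g n : ℝ)) atTop atTop :=
    tendsto_natCast_atTop_atTop.comp hg.tendsto_atTop
  have hyx : y = x := by
    have h0 : ‖y - x‖ ^ 4 ≤ 0 := by
      have h1 : Tendsto (fun n => ‖(q (g n)).2.1 - (q (g n)).1‖ ^ 4) atTop (𝓝 (‖y - x‖ ^ 4)) :=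
        ((hy.sub hx).norm).pow 4
      refine le_of_tendsto_of_tendsto h1 (hgw.div_atTop hgn) ?_
      filter_upwards [hgn.eventually_gt_atTop 0] with n hn
      rw [le_div_iff₀ hn]
      linarith [hqm (g n)]
    have h2 : ‖y - x‖ = 0 := by
      by_contra h
      have : 0 < ‖y - x‖ ^ 4 := by positivity
      linarith
    exact sub_eq_zero.1 (norm_eq_zero.1 h2)
  subst hyx
  have hnb : ¬ (y ∈ sphere 0 R ∨ t = t₀ ∨ t = t₁) := fun h => by
    linarith [hb y hlim.1 t hlim.2.2 h]
  push Not at hnb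
  have hyb : y ∈ ball 0 R := by
    rw [mem_ball]
    exact lt_of_le_of_ne hlim.1 hnb.1
  have htb : t ∈ Ioo t₀ t₁ :=
    ⟨lt_of_le_of_ne hlim.2.2.1 hnb.2.1.symm, lt_of_le_of_ne hlim.2.2.2 hnb.2.2⟩
  obtain ⟨n, hn0, hnx, hny, hnt⟩ := ((hgn.eventually_gt_atTop 0).and
    ((hx.eventually (isOpen_ball.mem_nhds hyb)).and ((hy.eventually (isOpen_ball.mem_nhds hyb)).and
      (ht.eventually (isOpen_Ioo.mem_nhds htb))))).exists
  exact ⟨g n, by exact_mod_cast hn0, _, hnx, _, hny, _, hnt, fun x' hx' y' hy' t' ht' =>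
    hq (g n) (x', y', t') ⟨ball_subset_closedBall hx', ball_subset_closedBall hy',
      Ioo_subset_Icc_self ht'⟩⟩

/-- Comparison of a viscosity subsolution with a smooth strict supersolution. -/
theorem IsViscositySubsol.le_of_strict_supersol {p R t₀ t₁ : ℝ}
    {w : EuclideanSpace ℝ (Fin N) → ℝ → ℝ} {φ : EuclideanSpace ℝ (Fin N) × ℝ → ℝ}
    (hw : IsViscositySubsol p (ball 0 R) w) (ht₀ : 0 < t₀)
    (hcont : ContinuousOn (fun q : EuclideanSpace ℝ (Fin N) × ℝ => w q.1 q.2)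
      (closedBall 0 R ×ˢ Icc t₀ t₁))
    (hφ : ContDiff ℝ 2 φ)
    (hne : ∀ x t, gradient (fun y => φ (y, t)) x ≠ 0 →
      Fop p (gradient (fun y => φ (y, t)) x) (hess (fun y => φ (y, t)) x) <
        deriv (fun s => φ (x, s)) t)
    (hzero : ∀ x t (C : ℝ), (∀ᶠ y in 𝓝 x, φ (x, t) ≤ φ (y, t) + C * ‖y - x‖ ^ 4) →
      0 < deriv (fun s => φ (x, s)) t)
    (hb : ∀ x ∈ closedBall 0 R, ∀ t ∈ Icc t₀ t₁,
      (x ∈ sphere 0 R ∨ t = t₀ ∨ t = t₁) → w x t ≤ φ (x, t)) :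
    ∀ x ∈ closedBall 0 R, ∀ t ∈ Icc t₀ t₁, w x t ≤ φ (x, t) := by
  intro x₀ hx₀ s₀ hs₀
  by_contra! hcon
  obtain ⟨n, hn, x, hx, y, hy, t, ht, hmax⟩ := exists_interior_max_of_doubling hφ.continuous hcont
    hb (sub_pos.2 hcon) ⟨x₀, hx₀, s₀, hs₀, le_rfl⟩
  have htpos : t ∈ Ioi (0 : ℝ) := ht₀.trans ht.1
  have hn' : (0 : ℝ) < n := by exact_mod_cast hn
  have hevx : ∀ᶠ q : EuclideanSpace ℝ (Fin N) × ℝ in 𝓝 (x, t), q.1 ∈ ball 0 R ∧ q.2 ∈ Ioo t₀ t₁ :=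
    (isOpen_ball.prod isOpen_Ioo).mem_nhds ⟨hx, ht⟩
  by_cases hg : gradient (fun y => φ (y, t)) y = 0
  · have hevy : ∀ᶠ y' in 𝓝 y, φ (y, t) + n * ‖y - x‖ ^ 4 ≤ φ (y', t) + n * ‖y' - x‖ ^ 4 := by
      filter_upwards [isOpen_ball.mem_nhds hy] with y' hy'
      linarith [hmax x hx y' hy' t ht]
    have hd : HasFDerivAt (fun y' => φ (y', t))
        (0 : EuclideanSpace ℝ (Fin N) →L[ℝ] ℝ) y := by
      have h1 : DifferentiableAt ℝ (fun y' => φ (y', t)) y := by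
        have : ContDiff ℝ 2 (fun y' => φ (y', t)) := by fun_prop
        exact this.differentiable (by norm_num) y
      have h2 : fderiv ℝ (fun y' => φ (y', t)) y = 0 := by
        rw [gradient] at hg
        simpa using hg
      rw [← h2]
      exact h1.hasFDerivAt
    have hyx : y = x := by
      have h1 := hd.add ((hasFDerivAt_norm_pow_four (n : ℝ) (y - x)).comp y
        ((hasFDerivAt_id y).sub_const x))
      have hloc : IsLocalMin ((fun y' => φ (y', t)) +
          (fun z : EuclideanSpace ℝ (Fin N) => (n : ℝ) * ‖z‖ ^ 4) ∘ fun y' => y' - x) y := hevy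
      have h2 : (0 : ℝ) + 4 * n * ‖y - x‖ ^ 2 * inner ℝ (y - x) (y - x) = 0 :=
        DFunLike.congr_fun (hloc.hasFDerivAt_eq_zero h1) (y - x)
      rw [zero_add, real_inner_self_eq_norm_sq] at h2
      by_contra h
      have : 0 < ‖y - x‖ := norm_pos_iff.2 (sub_ne_zero.2 h)
      have : 0 < 4 * n * ‖y - x‖ ^ 2 * ‖y - x‖ ^ 2 := by positivity
      linarith
    subst hyx
    have h1 := hzero y t n (by simpa using hevy)
    have h2 := (hw (fun q => φ (y, q.2) + n * ‖q.1 - y‖ ^ 4) (by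
        refine (hφ.comp (by fun_prop)).add (contDiff_const.mul ?_)
        have : ContDiff ℝ 2 fun q : EuclideanSpace ℝ (Fin N) × ℝ => (‖q.1 - y‖ ^ 2) ^ 2 :=
          ((contDiff_fst.sub contDiff_const).norm_sq ℝ).pow 2
        simpa only [← pow_mul] using this) y hy t htpos (by
        refine Filter.Eventually.filter_mono nhdsWithin_le_nhds ?_
        filter_upwards [hevx] with q hq
        have := hmax q.1 hq.1 y hy q.2 hq.2
        rw [norm_sub_rev y q.1] at this
        linarith)).2 (gradient_norm_sub_pow_four (n : ℝ) (φ (y, t)) y)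
        (hess_norm_sub_pow_four (n : ℝ) (φ (y, t)) y)
    simp only [deriv_add_const] at h2
    linarith
  · have e : x - (x - y) = y := by abel
    have h2 := (hw (fun q => φ (q.1 - (x - y), q.2)) (by fun_prop) x hx t htpos (by
      refine Filter.Eventually.filter_mono nhdsWithin_le_nhds ?_
      have hevy : ∀ᶠ q : EuclideanSpace ℝ (Fin N) × ℝ in 𝓝 (x, t), q.1 - (x - y) ∈ ball 0 R := by
        have hc : ContinuousAt (fun q : EuclideanSpace ℝ (Fin N) × ℝ => q.1 - (x - y)) (x, t) := by
          fun_prop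
        refine hc.eventually (isOpen_ball.mem_nhds ?_)
        simpa only [e] using hy
      filter_upwards [hevx, hevy] with q hq hqy
      have := hmax q.1 hq.1 _ hqy q.2 hq.2
      rw [sub_sub_cancel_left, neg_sub] at this
      simp only [e]
      linarith)).1
    rw [gradient_comp_sub (fun y => φ (y, t)), hess_comp_sub (fun y => φ (y, t))] at h2
    simp only [e] at h2
    exact absurd (h2 hg) (not_le.2 (hne y t hg))

end Comparison

section HeatSum

/-- Finite superpositions of separated radial solutions with exponential time dependence. -/
def heatSum {V : Type*} [NormedAddCommGroup V] (s : Finset ℕ) (κ : ℕ → ℝ) (a μ : ℝ)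
    (b : ℕ → ℝ) (x : V) (t : ℝ) : ℝ :=
  radialSum s κ a (fun k => b k * Real.exp (k * μ * t)) x

variable {N : ℕ}

theorem radialSum_const_mul {V : Type*} [NormedAddCommGroup V] (s : Finset ℕ) (κ : ℕ → ℝ)
    (a c : ℝ) (b : ℕ → ℝ) (x : V) :
    radialSum s κ a (fun k => c * b k) x = c * radialSum s κ a b x := by
  simp only [radialSum, Finset.mul_sum, mul_assoc]

theorem radialSum_neg {V : Type*} [NormedAddCommGroup V] (s : Finset ℕ) (κ : ℕ → ℝ)
    (a : ℝ) (b : ℕ → ℝ) (x : V) :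
    radialSum s κ a (fun k => -b k) x = -radialSum s κ a b x := by
  simp only [radialSum, neg_mul, Finset.sum_neg_distrib]

theorem hasDerivAt_heatSum {V : Type*} [NormedAddCommGroup V] (s : Finset ℕ) (κ : ℕ → ℝ)
    (a μ : ℝ) (b : ℕ → ℝ) (x : V) (t : ℝ) :
    HasDerivAt (heatSum s κ a μ b x)
      (radialSum s κ a (fun k => b k * Real.exp (k * μ * t) * (k * μ)) x) t := by
  unfold heatSum
  simp only [radialSum]
  refine HasDerivAt.fun_sum fun k _ => HasDerivAt.mul_const ?_ _
  have := (((hasDerivAt_id t).const_mul (k * μ)).exp).const_mul (b k)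
  simpa [mul_assoc] using this

theorem contDiff_heatSum {V : Type*} [NormedAddCommGroup V] [InnerProductSpace ℝ V]
    (s : Finset ℕ) (κ : ℕ → ℝ) {a : ℝ} (ha : -1 < a) (μ : ℝ) (b : ℕ → ℝ) (n : ℕ) :
    ContDiff ℝ n (fun q : V × ℝ => heatSum s κ a μ b q.1 q.2) := by
  simp only [heatSum, radialSum]
  refine ContDiff.sum fun k _ => ContDiff.mul ?_ ((contDiff_radialBessel ha (κ k) n).comp
    contDiff_fst)
  fun_prop

theorem Fop_radialSum {p : ℝ} (s : Finset ℕ) (κ : ℕ → ℝ) {a : ℝ}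
    (ha : -1 < a) (hap : a * (p - 1) = N - p) (b : ℕ → ℝ) (c : ℝ) {x : EuclideanSpace ℝ (Fin N)}
    (hx : gradient (fun y => radialSum s κ a b y + c) x ≠ 0) :
    Fop p (gradient (fun y => radialSum s κ a b y + c) x)
      (hess (fun y => radialSum s κ a b y + c) x) =
      (p - 1) / p * radialSum s κ a (fun k => b k * κ k ^ 2) x := by
  have h1 : ∀ y : EuclideanSpace ℝ (Fin N), HasFDerivAt (fun y => radialSum s κ a b y + c) _ y :=
    fun y => (hasFDerivAt_radialSum s κ ha b y).add_const c
  have h2 := hasFDerivAt_radialSum s κ (a := a + 2) (by linarith)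
    (fun k => b k * κ k ^ 2 / (a + 1)) x
  rw [gradient_eq_smul (h1 x)] at hx ⊢
  rw [hess_eq_of_hasFDerivAt h1 h2, Fop_of_hess_eq hx, ← radialSum_recurrence s κ ha b x]
  have : (N : ℝ) + p - 2 = (p - 1) * (a + 2) := by linarith
  rw [this]
  ring

theorem IsViscositySubsol.le_heatSum_add {p : ℝ} (hp : 1 < p) (hN : 2 ≤ N) {a μ : ℝ}
    (ha : -1 < a) (hap : a * (p - 1) = N - p) {κ : ℕ → ℝ}
    (hκ : ∀ k : ℕ, κ k ^ 2 = p / (p - 1) * (k * μ)) (s : Finset ℕ) (b : ℕ → ℝ)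
    {R t₀ t₁ T η K : ℝ} (hη : 0 < η) (hK : 0 < K) {w : EuclideanSpace ℝ (Fin N) → ℝ → ℝ}
    (hw : IsViscositySubsol p (ball 0 R) w) (ht₀ : 0 < t₀)
    (hcont : ContinuousOn (fun q : EuclideanSpace ℝ (Fin N) × ℝ => w q.1 q.2)
      (closedBall 0 R ×ˢ Icc t₀ t₁))
    (hb : ∀ x ∈ closedBall 0 R, ∀ t ∈ Icc t₀ t₁, (x ∈ sphere 0 R ∨ t = t₀ ∨ t = t₁) →
      w x t ≤ heatSum s κ a μ b x t + (η + η * Real.exp (K * (t - T)))) :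
    ∀ x ∈ closedBall 0 R, ∀ t ∈ Icc t₀ t₁,
      w x t ≤ heatSum s κ a μ b x t + (η + η * Real.exp (K * (t - T))) := by
  have hp0 : 0 < p - 1 := by linarith
  have : Nontrivial (EuclideanSpace ℝ (Fin N)) := by
    have : Nonempty (Fin N) := ⟨⟨0, by omega⟩⟩
    infer_instance
  have hcoef : ∀ (x : EuclideanSpace ℝ (Fin N)) t,
      radialSum s κ a (fun k => b k * Real.exp (k * μ * t) * (k * μ)) x =
        (p - 1) / p * radialSum s κ a (fun k => b k * Real.exp (k * μ * t) * κ k ^ 2) x := by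
    intro x t
    rw [← radialSum_const_mul]
    congr 1
    funext k
    rw [hκ]
    field_simp
  have hder : ∀ (x : EuclideanSpace ℝ (Fin N)) t, HasDerivAt
      (fun t => heatSum s κ a μ b x t + (η + η * Real.exp (K * (t - T))))
      (radialSum s κ a (fun k => b k * Real.exp (k * μ * t) * (k * μ)) x +
        η * (Real.exp (K * (t - T)) * K)) t := by
    intro x t
    refine (hasDerivAt_heatSum s κ a μ b x t).add (HasDerivAt.const_add _ (HasDerivAt.const_mul _ ?_))
    simpa using (((hasDerivAt_id t).sub_const T).const_mul K).exp
  have hpos : ∀ t, 0 < η * (Real.exp (K * (t - T)) * K) := fun t => by positivity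
  refine hw.le_of_strict_supersol (φ := fun q => heatSum s κ a μ b q.1 q.2 +
    (η + η * Real.exp (K * (q.2 - T)))) ht₀ hcont ?_ ?_ ?_ hb
  · exact (contDiff_heatSum s κ ha μ b 2).add (by fun_prop)
  · intro x t hx
    rw [(hder x t).deriv, hcoef]
    have h := Fop_radialSum s κ ha hap (fun k => b k * Real.exp (k * μ * t))
      (η + η * Real.exp (K * (t - T))) (x := x) hx
    refine lt_of_eq_of_lt h ?_
    linarith [hpos t]
  · intro x t C hC
    rw [(hder x t).deriv, hcoef]
    have h := radialSum_mul_sq_nonpos s κ ha (fun k => -(b k * Real.exp (k * μ * t))) (x := x)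
      (C := C) (by
        filter_upwards [hC] with y hy
        simp only [radialSum_neg, heatSum] at hy ⊢
        linarith)
    simp only [neg_mul, radialSum_neg] at h
    have : 0 ≤ (p - 1) / p := by positivity
    have := mul_nonneg this (neg_nonpos.1 h)
    linarith [hpos t]

end HeatSum

section InitialLayer

variable {N : ℕ}

theorem eventually_le_add_of_continuous {R M η : ℝ} (hη : 0 < η)
    {w v : EuclideanSpace ℝ (Fin N) → ℝ → ℝ}
    (hv : Continuous fun q : EuclideanSpace ℝ (Fin N) × ℝ => v q.1 q.2)
    (hc : ∀ x ∈ ball (0 : EuclideanSpace ℝ (Fin N)) R,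
      ContinuousWithinAt (fun q : EuclideanSpace ℝ (Fin N) × ℝ => w q.1 q.2)
        (closedBall 0 R ×ˢ Ici 0) (x, 0))
    (hM : ∀ x ∈ closedBall 0 R, ∀ t, 0 ≤ t → w x t ≤ M)
    (h0 : ∀ x ∈ ball (0 : EuclideanSpace ℝ (Fin N)) R, w x 0 ≤ v x 0)
    (hvM : ∀ x ∈ sphere 0 R, M ≤ v x 0) :
    ∀ᶠ t in 𝓝 (0 : ℝ), ∀ x ∈ closedBall 0 R, x ∈ closedBall 0 R → 0 < t → w x t ≤ v x t + η := by
  refine (isCompact_closedBall (0 : EuclideanSpace ℝ (Fin N))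
    R).eventually_forall_of_forall_eventually
    (P := fun t x => x ∈ closedBall 0 R → 0 < t → w x t ≤ v x t + η) fun x hx => ?_
  have hswap : Tendsto (fun z : ℝ × EuclideanSpace ℝ (Fin N) => (z.2, z.1)) (𝓝 (0, x))
      (𝓝 (x, 0)) := (continuous_swap.tendsto (0, x))
  rcases lt_or_eq_of_le (mem_closedBall.1 hx) with h | h
  · have h1 := (hc x h).sub (hv.continuousWithinAt (s := closedBall 0 R ×ˢ Ici 0) (x := (x, 0)))
    have h2 := h1.tendsto.eventually (eventually_lt_nhds (b := η)
      (show w x 0 - v x 0 < η by linarith [h0 x h]))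
    filter_upwards [hswap.eventually (eventually_nhdsWithin_iff.1 h2)] with z hz hzx hzt
    have h3 : w z.2 z.1 - v z.2 z.1 < η := hz ⟨hzx, hzt.le⟩
    linarith
  · have h2 := (hswap.eventually (hv.continuousAt.eventually
      (eventually_gt_nhds (b := M - η) (show M - η < v x 0 by linarith [hvM x h]))))
    filter_upwards [h2] with z hz hzx hzt
    linarith [hM z.2 hzx z.1 hzt.le]

theorem IsViscositySubsol.le_heatSum {p : ℝ} (hp : 1 < p) (hN : 2 ≤ N) {a μ : ℝ}
    (ha : -1 < a) (hap : a * (p - 1) = N - p) {κ : ℕ → ℝ}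
    (hκ : ∀ k : ℕ, κ k ^ 2 = p / (p - 1) * (k * μ)) (s : Finset ℕ) (b : ℕ → ℝ)
    {R T M : ℝ} {w : EuclideanSpace ℝ (Fin N) → ℝ → ℝ}
    (hw : IsViscositySubsol p (ball 0 R) w)
    (hc : ∀ x ∈ closedBall (0 : EuclideanSpace ℝ (Fin N)) R, ∀ t, 0 ≤ t →
      ¬(x ∈ sphere (0 : EuclideanSpace ℝ (Fin N)) R ∧ t = 0) →
      ContinuousWithinAt (fun q : EuclideanSpace ℝ (Fin N) × ℝ => w q.1 q.2)
        (closedBall 0 R ×ˢ Ici 0) (x, t))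
    (hM : ∀ x ∈ closedBall 0 R, ∀ t, 0 ≤ t → w x t ≤ M)
    (h0 : ∀ x ∈ ball (0 : EuclideanSpace ℝ (Fin N)) R, w x 0 ≤ heatSum s κ a μ b x 0)
    (hvM : ∀ x ∈ sphere (0 : EuclideanSpace ℝ (Fin N)) R, M ≤ heatSum s κ a μ b x 0)
    (hv : ∀ x ∈ sphere (0 : EuclideanSpace ℝ (Fin N)) R, ∀ t ∈ Ioc 0 (T + 1),
      w x t ≤ heatSum s κ a μ b x t) :
    ∀ x ∈ closedBall (0 : EuclideanSpace ℝ (Fin N)) R, ∀ t ∈ Ioc 0 T,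
      w x t ≤ heatSum s κ a μ b x t := by
  intro x hx t ht
  have hvc : Continuous fun q : EuclideanSpace ℝ (Fin N) × ℝ => heatSum s κ a μ b q.1 q.2 :=
    (contDiff_heatSum s κ ha μ b 0).continuous
  obtain ⟨m, hm⟩ := ((isCompact_closedBall (0 : EuclideanSpace ℝ (Fin N)) R).image
    (f := fun y => heatSum s κ a μ b y (T + 1)) (by fun_prop)).bddBelow
  refine le_of_forall_pos_le_add fun ε hε => ?_
  obtain ⟨η, hη, rfl⟩ : ∃ η, 0 < η ∧ ε = 2 * η := ⟨ε / 2, by linarith, by ring⟩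
  obtain ⟨τ, hτ, hτ0⟩ := (((eventually_le_add_of_continuous hη hvc (fun x hx => hc x
    (ball_subset_closedBall hx) 0 le_rfl fun h => (mem_ball.1 hx).ne h.1) hM h0 hvM).filter_mono
      nhdsWithin_le_nhds).and (Ioo_mem_nhdsGT ht.1)).exists
  set K : ℝ := max 1 ((M - m) / η) with hKdef
  have hK : 0 < K := lt_of_lt_of_le one_pos (le_max_left _ _)
  have hbig : M - m ≤ η * Real.exp K := by
    have h1 : (M - m) / η ≤ Real.exp K := (le_max_right _ _).trans (by
      linarith [Real.add_one_le_exp K])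
    rw [div_le_iff₀ hη] at h1
    linarith
  have key := hw.le_heatSum_add hp hN ha hap hκ s b (t₀ := τ) (t₁ := T + 1) (T := T) hη hK hτ0.1
    (fun q hq => (hc q.1 hq.1 q.2 (hτ0.1.le.trans hq.2.1) fun h => by
      linarith [hq.2.1, hτ0.1, h.2]).mono (prod_mono le_rfl fun r hr => hτ0.1.le.trans hr.1)) (by
    intro y hy r hr h
    have he : 0 < η * Real.exp (K * (r - T)) := by positivity
    rcases h with h | rfl | rfl
    · linarith [hv y h r ⟨hτ0.1.trans_le hr.1, hr.2⟩]
    · linarith [hτ y hy hy hτ0.1]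
    · have h1 := hm ⟨y, hy, rfl⟩
      rw [add_sub_cancel_left, mul_one] at he ⊢
      simp only at h1
      linarith [hM y hy (T + 1) (by linarith [ht.1, ht.2])]) x hx t
        ⟨hτ0.2.le, by linarith [ht.2]⟩
  have hexp : Real.exp (K * (t - T)) ≤ 1 :=
    Real.exp_le_one_iff.2 (mul_nonpos_of_nonneg_of_nonpos hK.le (by linarith [ht.2]))
  nlinarith

end InitialLayer

section MaximumPrinciple

variable {V : Type*} [NormedAddCommGroup V] [InnerProductSpace ℝ V]

theorem deriv_nonneg_of_le_left {h : ℝ → ℝ} {d s l : ℝ} (hd : HasDerivAt h d s) (hl : l < s)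
    (hmax : ∀ r ∈ Ioo l s, h r ≤ h s) : 0 ≤ d := by
  refine ge_of_tendsto (hd.tendsto_slope.mono_left (nhdsLT_le_nhdsNE s)) ?_
  filter_upwards [Ioo_mem_nhdsLT hl] with r hr
  rw [slope_def_field]
  exact div_nonneg_of_nonpos (by linarith [hmax r hr]) (by linarith [hr.2])

theorem continuous_radialBessel {a : ℝ} (ha : -1 < a) (κ : ℝ) :
    Continuous (radialBessel a κ : V → ℝ) :=
  (contDiff_radialBessel ha κ 0).continuous

/-- Maximum principle for superpositions whose boundary values are polynomials in `s`. -/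
theorem radialSum_pow_le [FiniteDimensional ℝ V] [Nontrivial V] {a m R L C : ℝ} (ha : -1 < a)
    (hm : 0 < m) (hR : 0 ≤ R) {κ : ℕ → ℝ} (hκ : ∀ k : ℕ, κ k ^ 2 = m * k) (S : Finset ℕ)
    (b : ℕ → ℝ)
    (hb : ∀ y ∈ sphere (0 : V) R, ∀ s ∈ Icc 0 L, radialSum S κ a (fun k => b k * s ^ k) y ≤ C) :
    ∀ x ∈ closedBall (0 : V) R, ∀ s ∈ Icc 0 L, radialSum S κ a (fun k => b k * s ^ k) x ≤ C := by
  intro x hx s hs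
  have hzero : ∀ z ∈ closedBall (0 : V) R, radialSum S κ a (fun k => b k * (0 : ℝ) ^ k) z ≤ C := by
    intro z _
    obtain ⟨y, hy⟩ := NormedSpace.sphere_nonempty (E := V) (x := 0) (r := R) |>.2 hR
    refine le_of_eq_of_le ?_ (hb y hy 0 ⟨le_rfl, hs.1.trans hs.2⟩)
    refine Finset.sum_congr rfl fun k _ => ?_
    rcases eq_or_ne k 0 with rfl | hk
    · have : κ 0 = 0 := by simpa using hκ 0
      simp [radialBessel, this]
    · simp [hk]
  have hlim : ∀ η : ℝ, 0 < η → radialSum S κ a (fun k => b k * s ^ k) x ≤ C + η * s := by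
    intro η hη
    have hcont : Continuous fun q : V × ℝ =>
        radialSum S κ a (fun k => b k * q.2 ^ k) q.1 - η * q.2 := by
      refine Continuous.sub ?_ (by fun_prop)
      simp only [radialSum]
      refine continuous_finsetSum _ fun k _ => Continuous.mul (by fun_prop)
        ((continuous_radialBessel ha (κ k)).comp continuous_fst)
    obtain ⟨⟨z, r⟩, ⟨hz, hr⟩, hmax⟩ := ((isCompact_closedBall (0 : V) R).prod
      (isCompact_Icc (a := (0 : ℝ)) (b := L))).exists_isMaxOn ⟨(x, s), hx, hs⟩ hcont.continuousOn
    have hmax' : ∀ z' ∈ closedBall (0 : V) R, ∀ r' ∈ Icc 0 L,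
        radialSum S κ a (fun k => b k * r' ^ k) z' - η * r' ≤
          radialSum S κ a (fun k => b k * r ^ k) z - η * r := fun z' hz' r' hr' =>
      hmax (a := (z', r')) ⟨hz', hr'⟩
    suffices h : radialSum S κ a (fun k => b k * r ^ k) z ≤ C by
      have hηr : 0 ≤ η * r := mul_nonneg hη.le hr.1
      linarith [hmax' x hx s hs]
    rcases eq_or_lt_of_le hr.1 with h0 | hr0
    · simp only at h0
      rw [← h0]
      exact hzero z hz
    rcases lt_or_eq_of_le (mem_closedBall.1 hz) with hzR | hzR
    · exfalso
      have h1 := radialSum_mul_sq_nonpos S κ ha (fun k => b k * r ^ k) (x := z) (C := 0) (by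
        filter_upwards [isOpen_ball.mem_nhds (mem_ball.2 hzR)] with y hy
        linarith [hmax' y (ball_subset_closedBall hy) r hr])
      have hd : HasDerivAt (fun r => radialSum S κ a (fun k => b k * r ^ k) z - η * r)
          (radialSum S κ a (fun k => b k * (k * r ^ (k - 1))) z - η) r := by
        refine HasDerivAt.sub ?_ (by simpa using (hasDerivAt_id r).const_mul η)
        simp only [radialSum]
        exact HasDerivAt.fun_sum fun k _ => ((hasDerivAt_pow k r).const_mul _).mul_const _
      have h2 := deriv_nonneg_of_le_left hd hr0 fun r' hr' =>
        hmax' z hz r' ⟨hr'.1.le, hr'.2.le.trans hr.2⟩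
      have h3 : radialSum S κ a (fun k => b k * r ^ k * κ k ^ 2) z =
          m * r * radialSum S κ a (fun k => b k * (k * r ^ (k - 1))) z := by
        rw [← radialSum_const_mul]
        congr 1
        funext k
        rw [hκ]
        rcases eq_or_ne k 0 with rfl | hk
        · simp
        · obtain ⟨j, rfl⟩ := Nat.exists_eq_succ_of_ne_zero hk
          simp only [Nat.succ_eq_add_one, Nat.add_sub_cancel, pow_succ]
          ring
      rw [h3] at h1
      have : 0 < m * r * radialSum S κ a (fun k => b k * (k * r ^ (k - 1))) z :=
        mul_pos (mul_pos hm hr0) (by linarith)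
      linarith
    · exact hb z hzR r hr
  refine le_of_forall_pos_le_add fun ε hε => ?_
  have h1 : 0 < s + 1 := by linarith [hs.1]
  refine (hlim (ε / (s + 1)) (by positivity)).trans ?_
  have : ε / (s + 1) * s ≤ ε := by
    rw [div_mul_eq_mul_div, div_le_iff₀ h1]
    nlinarith
  linarith

end MaximumPrinciple

section BoundaryProfile

/-- A polynomial profile that is nearly `0` before `s₀`, exceeds `M` at `1` and is nearly `β`
after `s₁`. -/
theorem exists_polynomial_profile {s₀ s₁ L M β η : ℝ} (hs₀ : s₀ < 1) (hs₁ : 1 < s₁)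
    (hβ : |β| ≤ M) (hη : 0 < η) :
    ∃ P : Polynomial ℝ, ∀ s ∈ Icc 0 L, (s ≤ 1 → 0 ≤ P.eval s) ∧ (s = 1 → M ≤ P.eval s) ∧
      (1 ≤ s → β ≤ P.eval s) ∧ (s ≤ s₀ → P.eval s ≤ 2 * η) ∧
      (s₁ ≤ s → P.eval s ≤ β + 2 * η) ∧ P.eval s ≤ M + 2 * η ∧ -M ≤ P.eval s := by
  set A : ℝ → ℝ := fun s => max 0 (min 1 ((s - s₀) / (1 - s₀))) with hA
  set B : ℝ → ℝ := fun s => max 0 (min 1 ((s - 1) / (s₁ - 1))) with hB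
  have h0 : 0 < 1 - s₀ := by linarith
  have h1 : 0 < s₁ - 1 := by linarith
  have hβ' := abs_le.1 hβ
  have hA0 : ∀ s, 0 ≤ A s := fun s => le_max_left _ _
  have hB0 : ∀ s, 0 ≤ B s := fun s => le_max_left _ _
  have hA1 : ∀ s, A s ≤ 1 := fun s => max_le zero_le_one (min_le_left _ _)
  have hB1 : ∀ s, B s ≤ 1 := fun s => max_le zero_le_one (min_le_left _ _)
  have hAz : ∀ s, s ≤ s₀ → A s = 0 := fun s hs => max_eq_left ((min_le_right _ _).trans
    (div_nonpos_of_nonpos_of_nonneg (by linarith) h0.le))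
  have hBz : ∀ s, s ≤ 1 → B s = 0 := fun s hs => max_eq_left ((min_le_right _ _).trans
    (div_nonpos_of_nonpos_of_nonneg (by linarith) h1.le))
  have hAo : ∀ s, 1 ≤ s → A s = 1 := fun s hs => by
    have : 1 ≤ (s - s₀) / (1 - s₀) := (one_le_div h0).2 (by linarith)
    simp [hA, this]
  have hBo : ∀ s, s₁ ≤ s → B s = 1 := fun s hs => by
    have : 1 ≤ (s - 1) / (s₁ - 1) := (one_le_div h1).2 (by linarith)
    simp [hB, this]
  obtain ⟨P, hP⟩ := exists_polynomial_near_of_continuousOn 0 L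
    (fun s => M * A s - (M - β) * B s + η) (by fun_prop) η hη
  have hM : 0 ≤ M := (abs_nonneg β).trans hβ
  refine ⟨P, fun s hs => ?_⟩
  have hPs := abs_lt.1 (hP s hs)
  have hMA : 0 ≤ M * A s := mul_nonneg hM (hA0 s)
  have hMA1 : M * A s ≤ M := mul_le_of_le_one_right hM (hA1 s)
  have hMB : 0 ≤ (M - β) * B s := mul_nonneg (by linarith) (hB0 s)
  have hMB1 : (M - β) * B s ≤ M - β := mul_le_of_le_one_right (by linarith) (hB1 s)
  have hpos : s ≤ 1 → 0 ≤ P.eval s := fun h => by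
    rw [hBz s h] at hPs
    linarith
  have hge : 1 ≤ s → β ≤ P.eval s := fun h => by
    rw [hAo s h] at hPs
    linarith
  refine ⟨hpos, fun h => ?_, hge, fun h => ?_, fun h => ?_, by linarith, ?_⟩
  · rw [hAo s h.ge, hBz s h.le] at hPs
    linarith
  · rw [hAz s h] at hPs
    linarith
  · rw [hAo s (by linarith), hBo s h] at hPs
    linarith
  · rcases le_total s 1 with h | h
    · linarith [hpos h]
    · linarith [hge h]

end BoundaryProfile

section LaplaceTransform

variable {V : Type*} [NormedAddCommGroup V]

theorem radialSum_le_of_sub_le [InnerProductSpace ℝ V] [FiniteDimensional ℝ V] [Nontrivial V]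
    {a m R E : ℝ} (ha : -1 < a) (hm : 0 < m) {κ : ℕ → ℝ} (hκ : ∀ k : ℕ, κ k ^ 2 = m * k)
    (S : Finset ℕ) (d : ℕ → ℝ) (hb : ∀ y ∈ sphere (0 : V) R, radialSum S κ a d y ≤ E)
    (hd : ∀ y ∈ ball (0 : V) R, radialSum S κ a (fun k => d k * (1 - k)) y ≤ E) :
    ∀ x ∈ closedBall (0 : V) R, radialSum S κ a d x ≤ E := by
  intro x hx
  have hcont : Continuous (radialSum S κ a d : V → ℝ) :=
    continuous_iff_continuousAt.2 fun y => (hasFDerivAt_radialSum S κ ha d y).continuousAt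
  obtain ⟨z, hz, hmax⟩ := (isCompact_closedBall (0 : V) R).exists_isMaxOn ⟨x, hx⟩
    hcont.continuousOn
  refine (hmax hx).trans ?_
  rcases lt_or_eq_of_le (mem_closedBall.1 hz) with hzR | hzR
  · have h1 := radialSum_mul_sq_nonpos S κ ha d (x := z) (C := 0) (by
      filter_upwards [isOpen_ball.mem_nhds (mem_ball.2 hzR)] with y hy
      rw [zero_mul, add_zero]
      exact hmax (ball_subset_closedBall hy))
    have h2 : radialSum S κ a (fun k => d k * κ k ^ 2) z =
        m * (radialSum S κ a d z - radialSum S κ a (fun k => d k * (1 - k)) z) := by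
      simp only [radialSum, hκ, ← Finset.sum_sub_distrib, Finset.mul_sum]
      exact Finset.sum_congr rfl fun k _ => by ring
    rw [h2] at h1
    have h3 := hd z hzR
    have h4 := nonpos_of_mul_nonpos_right h1 hm
    change radialSum S κ a d z ≤ E
    linarith
  · exact hb z hzR

theorem integral_heatSum (S : Finset ℕ) (κ : ℕ → ℝ) (a μ : ℝ) (b : ℕ → ℝ) (x : V) (l r : ℝ) :
    ∫ τ in l..r, μ * Real.exp (-μ * τ) * heatSum S κ a μ b x τ =
      radialSum S κ a (fun k => b k * ∫ τ in l..r, μ * Real.exp (-μ * τ) * Real.exp (k * μ * τ))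
        x := by
  simp only [heatSum, radialSum, Finset.mul_sum]
  rw [intervalIntegral.integral_finsetSum fun k _ =>
    Continuous.intervalIntegrable (by fun_prop) _ _]
  refine Finset.sum_congr rfl fun k _ => ?_
  rw [← intervalIntegral.integral_const_mul, ← intervalIntegral.integral_mul_const]
  congr 1
  funext τ
  ring

theorem one_sub_mul_integral_exp (μ k l r : ℝ) :
    (1 - k) * ∫ τ in l..r, μ * Real.exp (-μ * τ) * Real.exp (k * μ * τ) =
      Real.exp (-μ * l) * Real.exp (k * μ * l) - Real.exp (-μ * r) * Real.exp (k * μ * r) := by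
  rw [← intervalIntegral.integral_const_mul, ← neg_sub_neg (Real.exp (-μ * r) * _)]
  refine intervalIntegral.integral_eq_sub_of_hasDerivAt
    (f := fun τ => -(Real.exp (-μ * τ) * Real.exp (k * μ * τ))) (fun τ _ => ?_)
    (Continuous.intervalIntegrable ?_ _ _)
  swap
  · fun_prop
  have h := ((((hasDerivAt_id τ).const_mul (-μ)).exp).mul
    (((hasDerivAt_id τ).const_mul (k * μ)).exp)).neg
  refine h.congr_deriv ?_
  simp only [id]
  ring

theorem integral_mul_exp_neg (μ l r : ℝ) :
    ∫ τ in l..r, μ * Real.exp (-μ * τ) = Real.exp (-μ * l) - Real.exp (-μ * r) := by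
  simpa using one_sub_mul_integral_exp μ 0 l r

theorem heatSum_eq_radialSum_pow (S : Finset ℕ) (κ : ℕ → ℝ) (a μ : ℝ) (b : ℕ → ℝ) (x : V)
    (t : ℝ) :
    heatSum S κ a μ b x t = radialSum S κ a (fun k => b k * Real.exp (μ * t) ^ k) x := by
  simp only [heatSum, ← Real.exp_nat_mul, mul_assoc]

theorem radialSum_eq_eval {a R : ℝ} (ha : -1 < a) (κ : ℕ → ℝ) (P : Polynomial ℝ) {S : Finset ℕ}
    (hS : P.support ⊆ S) {y : V} (hy : y ∈ sphere (0 : V) R) (s : ℝ) :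
    radialSum S κ a (fun k => P.coeff k / besselInt a (κ k * R) * s ^ k) y = P.eval s := by
  rw [Polynomial.eval_eq_sum, Polynomial.sum_def, radialSum,
    ← Finset.sum_subset hS fun k _ hk => by simp [Polynomial.notMem_support_iff.1 hk]]
  refine Finset.sum_congr rfl fun k _ => ?_
  have hne := (besselInt_pos ha (κ k * R)).ne'
  rw [radialBessel, mem_sphere_zero_iff_norm.1 hy]
  field_simp

end LaplaceTransform

section LaplaceBound

variable {N : ℕ}

theorem laplace_le_add {p : ℝ} (hp : 1 < p) (hN : 2 ≤ N) {a μ : ℝ} (hμ : 0 < μ)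
    (ha : -1 < a) (hap : a * (p - 1) = N - p) {κ : ℕ → ℝ}
    (hκ : ∀ k : ℕ, κ k ^ 2 = p / (p - 1) * (k * μ))
    {R T M β δ η : ℝ} (hR : 0 < R) (hδ : 0 < δ) (hη : 0 < η) (hT : δ ≤ T) (hβ : |β| ≤ M)
    {w : EuclideanSpace ℝ (Fin N) → ℝ → ℝ}
    (hw : IsViscositySubsol p (ball 0 R) w)
    (hc : ∀ x ∈ closedBall (0 : EuclideanSpace ℝ (Fin N)) R, ∀ t, 0 ≤ t →
      ¬(x ∈ sphere (0 : EuclideanSpace ℝ (Fin N)) R ∧ t = 0) →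
      ContinuousWithinAt (fun q : EuclideanSpace ℝ (Fin N) × ℝ => w q.1 q.2)
        (closedBall 0 R ×ˢ Ici 0) (x, t))
    (hM : ∀ x ∈ closedBall 0 R, ∀ t, 0 ≤ t → w x t ≤ M)
    (h0 : ∀ x ∈ ball (0 : EuclideanSpace ℝ (Fin N)) R, w x 0 = 0)
    (hwβ : ∀ x ∈ sphere (0 : EuclideanSpace ℝ (Fin N)) R, ∀ t, 0 < t → w x t = β)
    {x : EuclideanSpace ℝ (Fin N)} (hx : x ∈ closedBall 0 R)
    (hint : IntervalIntegrable (fun τ => μ * Real.exp (-μ * τ) * w x τ) volume 0 T) :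
    ∫ τ in (0 : ℝ)..T, μ * Real.exp (-μ * τ) * w x τ ≤
      β * (radialBessel a (κ 1) x / besselInt a (κ 1 * R)) +
        max ((M + 2 * η) * (Real.exp (μ * δ) - Real.exp (-μ * δ)) +
          (β + 2 * η) * (Real.exp (-μ * δ) - Real.exp (-μ * T)) - β)
          (Real.exp (μ * δ) * (2 * η) + Real.exp (-μ * T) * M) := by
  have hp0 : 0 < p - 1 := by linarith
  have : Nontrivial (EuclideanSpace ℝ (Fin N)) := by
    have : Nonempty (Fin N) := ⟨⟨0, by omega⟩⟩
    infer_instance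
  have hm : 0 < p / (p - 1) * μ := by positivity
  have hκ' : ∀ k : ℕ, κ k ^ 2 = p / (p - 1) * μ * k := fun k => by rw [hκ]; ring
  have hT0 : 0 < T := hδ.trans_le hT
  obtain ⟨P, hP⟩ := exists_polynomial_profile (s₀ := Real.exp (-μ * δ)) (s₁ := Real.exp (μ * δ))
    (L := Real.exp (μ * (T + 1))) (Real.exp_lt_one_iff.2 (by nlinarith))
    (Real.one_lt_exp_iff.2 (by positivity)) hβ hη
  have hexp : ∀ {t}, t ≤ T + 1 → Real.exp (μ * t) ∈ Icc 0 (Real.exp (μ * (T + 1))) := fun h =>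
    ⟨(Real.exp_pos _).le, Real.exp_le_exp.2 (mul_le_mul_of_nonneg_left h hμ.le)⟩
  set S : Finset ℕ := insert 1 P.support with hS
  set b : ℕ → ℝ := fun k => P.coeff k / besselInt a (κ k * R) with hb
  have hbd : ∀ y ∈ sphere (0 : EuclideanSpace ℝ (Fin N)) R, ∀ s,
      radialSum S κ a (fun k => b k * s ^ k) y = P.eval s := fun y hy s =>
    radialSum_eq_eval ha κ P (Finset.subset_insert _ _) hy s
  have hbd' : ∀ y ∈ sphere (0 : EuclideanSpace ℝ (Fin N)) R, ∀ t,
      heatSum S κ a μ b y t = P.eval (Real.exp (μ * t)) := fun y hy t => by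
    rw [heatSum_eq_radialSum_pow, hbd y hy]
  have hlow : ∀ L C : ℝ, (∀ s ∈ Icc 0 L, C ≤ P.eval s) →
      ∀ y ∈ closedBall (0 : EuclideanSpace ℝ (Fin N)) R, ∀ t, Real.exp (μ * t) ≤ L →
        C ≤ heatSum S κ a μ b y t := by
    intro L C h y hy t ht
    have := radialSum_pow_le (V := EuclideanSpace ℝ (Fin N)) (C := -C) ha hm hR.le hκ' S
      (fun k => -b k) (fun z hz s hs => by
        simp only [neg_mul, radialSum_neg, hbd z hz]
        linarith [h s hs]) y hy (Real.exp (μ * t)) ⟨(Real.exp_pos _).le, ht⟩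
    simp only [neg_mul, radialSum_neg] at this
    rw [heatSum_eq_radialSum_pow]
    linarith
  have hupp : ∀ L C : ℝ, (∀ s ∈ Icc 0 L, P.eval s ≤ C) →
      ∀ y ∈ closedBall (0 : EuclideanSpace ℝ (Fin N)) R, ∀ t, Real.exp (μ * t) ≤ L →
        heatSum S κ a μ b y t ≤ C := by
    intro L C h y hy t ht
    rw [heatSum_eq_radialSum_pow]
    exact radialSum_pow_le ha hm hR.le hκ' S b (fun z hz s hs => by
      rw [hbd z hz]
      exact h s hs) y hy (Real.exp (μ * t)) ⟨(Real.exp_pos _).le, ht⟩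
  have hone : (1 : ℝ) ≤ Real.exp (μ * (T + 1)) := Real.one_le_exp (by positivity)
  have hnonneg : ∀ y ∈ closedBall (0 : EuclideanSpace ℝ (Fin N)) R, ∀ t ≤ 0,
      0 ≤ heatSum S κ a μ b y t := fun y hy t ht =>
    hlow 1 0 (fun s hs => (hP s ⟨hs.1, hs.2.trans hone⟩).1 hs.2) y hy t
      (Real.exp_le_one_iff.2 (mul_nonpos_of_nonneg_of_nonpos hμ.le ht))
  have hcmp := hw.le_heatSum hp hN ha hap hκ S b (T := T) hc hM
    (fun y hy => by
      rw [h0 y hy]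
      exact hnonneg y (ball_subset_closedBall hy) 0 le_rfl)
    (fun y hy => by
      rw [hbd' y hy]
      exact (hP _ (hexp (by linarith))).2.1 (by simp))
    (fun y hy t ht => by
      rw [hbd' y hy, hwβ y hy t ht.1]
      exact (hP _ (hexp ht.2)).2.2.1 (Real.one_le_exp (mul_nonneg hμ.le ht.1.le)))
  have hvint : ∀ (y : EuclideanSpace ℝ (Fin N)) (l r : ℝ), IntervalIntegrable
      (fun τ => μ * Real.exp (-μ * τ) * heatSum S κ a μ b y τ) volume l r := fun y l r =>
    Continuous.intervalIntegrable (by simp only [heatSum, radialSum]; fun_prop) l r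
  have hstep : ∫ τ in (0 : ℝ)..T, μ * Real.exp (-μ * τ) * w x τ ≤
      ∫ τ in (-δ)..T, μ * Real.exp (-μ * τ) * heatSum S κ a μ b x τ := by
    rw [← intervalIntegral.integral_add_adjacent_intervals (hvint x (-δ) 0) (hvint x 0 T)]
    have h1 : 0 ≤ ∫ τ in (-δ)..0, μ * Real.exp (-μ * τ) * heatSum S κ a μ b x τ :=
      intervalIntegral.integral_nonneg (by linarith) fun τ hτ =>
        mul_nonneg (by positivity) (hnonneg x hx τ hτ.2)
    have h2 := intervalIntegral.integral_mono_on_of_le_Ioo hT0.le hint (hvint x 0 T)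
      fun τ hτ => mul_le_mul_of_nonneg_left (hcmp x hx τ ⟨hτ.1, hτ.2.le⟩)
        (by positivity : 0 ≤ μ * Real.exp (-μ * τ))
    linarith
  refine hstep.trans ?_
  set c : ℕ → ℝ := fun k => ∫ τ in (-δ)..T, μ * Real.exp (-μ * τ) * Real.exp (k * μ * τ) with hcdef
  set d : ℕ → ℝ := fun k => b k * c k - if k = 1 then β / besselInt a (κ 1 * R) else 0 with hd
  have hV : ∀ y : EuclideanSpace ℝ (Fin N), radialSum S κ a d y =
      (∫ τ in (-δ)..T, μ * Real.exp (-μ * τ) * heatSum S κ a μ b y τ) -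
        β * (radialBessel a (κ 1) y / besselInt a (κ 1 * R)) := by
    intro y
    rw [integral_heatSum]
    simp only [radialSum, hd, sub_mul, Finset.sum_sub_distrib, ite_mul, zero_mul]
    rw [Finset.sum_ite_eq' S 1, if_pos (Finset.mem_insert_self _ _)]
    ring
  have hfin := radialSum_le_of_sub_le (V := EuclideanSpace ℝ (Fin N)) (R := R)
    (E := max ((M + 2 * η) * (Real.exp (μ * δ) - Real.exp (-μ * δ)) +
          (β + 2 * η) * (Real.exp (-μ * δ) - Real.exp (-μ * T)) - β)
          (Real.exp (μ * δ) * (2 * η) + Real.exp (-μ * T) * M)) ha hm hκ' S d ?_ ?_ x hx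
  · rw [hV] at hfin
    linarith
  · intro y hy
    refine le_trans ?_ (le_max_left _ _)
    rw [hV, ← intervalIntegral.integral_add_adjacent_intervals (hvint y (-δ) δ) (hvint y δ T)]
    have hne := (besselInt_pos ha (κ 1 * R)).ne'
    rw [radialBessel, mem_sphere_zero_iff_norm.1 hy, div_self hne, mul_one]
    have hmono : ∀ l r B : ℝ, l ≤ r →
        (∀ τ ∈ Icc l r, heatSum S κ a μ b y τ ≤ B) →
        ∫ τ in l..r, μ * Real.exp (-μ * τ) * heatSum S κ a μ b y τ ≤
          B * (Real.exp (-μ * l) - Real.exp (-μ * r)) := by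
      intro l r B hlr hB
      rw [← integral_mul_exp_neg, ← intervalIntegral.integral_const_mul]
      refine intervalIntegral.integral_mono_on hlr (hvint y l r)
        (Continuous.intervalIntegrable (by fun_prop) _ _) fun τ hτ => ?_
      rw [mul_comm B]
      exact mul_le_mul_of_nonneg_left (hB τ hτ) (by positivity)
    have h1 := hmono (-δ) δ (M + 2 * η) (by linarith) fun τ hτ => by
      rw [hbd' y hy]
      exact (hP _ (hexp (by linarith [hτ.2]))).2.2.2.2.2.1
    have h2 := hmono δ T (β + 2 * η) hT fun τ hτ => by
      rw [hbd' y hy]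
      exact (hP _ (hexp (by linarith [hτ.2]))).2.2.2.2.1
        (Real.exp_le_exp.2 (mul_le_mul_of_nonneg_left hτ.1 hμ.le))
    rw [neg_mul_neg] at h1
    linarith
  · intro y hy
    refine le_trans ?_ (le_max_right _ _)
    have hy' := ball_subset_closedBall hy
    have e : radialSum S κ a (fun k => d k * (1 - k)) y =
        Real.exp (μ * δ) * heatSum S κ a μ b y (-δ) - Real.exp (-μ * T) * heatSum S κ a μ b y T := by
      rw [heatSum, heatSum, ← radialSum_const_mul, ← radialSum_const_mul, radialSum, radialSum,
        radialSum, ← Finset.sum_sub_distrib]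
      refine Finset.sum_congr rfl fun k _ => ?_
      rw [← sub_mul]
      congr 1
      have h1 : (if k = 1 then β / besselInt a (κ 1 * R) else 0) * (1 - (k : ℝ)) = 0 := by
        split_ifs with h
        · simp [h]
        · simp
      have h2 := one_sub_mul_integral_exp μ k (-δ) T
      rw [neg_mul_neg] at h2
      calc d k * (1 - k) = b k * ((1 - k) * c k) -
            (if k = 1 then β / besselInt a (κ 1 * R) else 0) * (1 - (k : ℝ)) := by
              simp only [hd]
              ring
        _ = _ := by
          rw [h1, h2]
          ring
    rw [e]
    have h1 := hupp (Real.exp (-μ * δ)) (2 * η) (fun s hs =>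
      (hP s ⟨hs.1, hs.2.trans ((Real.exp_le_one_iff.2 (by nlinarith)).trans hone)⟩).2.2.2.1 hs.2)
      y hy' (-δ) (by rw [mul_neg, neg_mul])
    have h2 := hlow (Real.exp (μ * (T + 1))) (-M) (fun s hs => (hP s hs).2.2.2.2.2.2) y hy' T
      (hexp (by linarith)).2
    have h3 := mul_le_mul_of_nonneg_left h1 (Real.exp_pos (μ * δ)).le
    have h4 := mul_le_mul_of_nonneg_left h2 (Real.exp_pos (-μ * T)).le
    linarith

end LaplaceBound

section LaplaceIdentity

variable {N : ℕ}

theorem laplace_le {p : ℝ} (hp : 1 < p) (hN : 2 ≤ N) {a μ : ℝ} (hμ : 0 < μ)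
    (ha : -1 < a) (hap : a * (p - 1) = N - p) {κ : ℕ → ℝ}
    (hκ : ∀ k : ℕ, κ k ^ 2 = p / (p - 1) * (k * μ))
    {R M β : ℝ} (hR : 0 < R) (hβ : |β| ≤ M)
    {w : EuclideanSpace ℝ (Fin N) → ℝ → ℝ}
    (hw : IsViscositySubsol p (ball 0 R) w)
    (hc : ∀ x ∈ closedBall (0 : EuclideanSpace ℝ (Fin N)) R, ∀ t, 0 ≤ t →
      ¬(x ∈ sphere (0 : EuclideanSpace ℝ (Fin N)) R ∧ t = 0) →
      ContinuousWithinAt (fun q : EuclideanSpace ℝ (Fin N) × ℝ => w q.1 q.2)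
        (closedBall 0 R ×ˢ Ici 0) (x, t))
    (hM : ∀ x ∈ closedBall 0 R, ∀ t, 0 ≤ t → |w x t| ≤ M)
    (h0 : ∀ x ∈ ball (0 : EuclideanSpace ℝ (Fin N)) R, w x 0 = 0)
    (hwβ : ∀ x ∈ sphere (0 : EuclideanSpace ℝ (Fin N)) R, ∀ t, 0 < t → w x t = β)
    {x : EuclideanSpace ℝ (Fin N)} (hx : x ∈ closedBall 0 R) :
    ∫ τ in Ioi (0 : ℝ), μ * Real.exp (-μ * τ) * w x τ ≤
      β * (radialBessel a (κ 1) x / besselInt a (κ 1 * R)) := by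
  have hint : IntegrableOn (fun τ => μ * Real.exp (-μ * τ) * w x τ) (Ioi (0 : ℝ)) := by
    have hwc : ContinuousOn (fun τ => w x τ) (Ioi (0 : ℝ)) := fun τ hτ =>
      (hc x hx τ (le_of_lt hτ) fun h => (ne_of_gt hτ) h.2).comp
        (f := fun τ => (x, τ)) (by fun_prop) fun r hr => ⟨hx, Ioi_subset_Ici_self hr⟩
    refine Integrable.mono' (((integrableOn_exp_mul_Ioi (neg_lt_zero.2 hμ) 0).const_mul
      μ).mul_const M) (ContinuousOn.aestronglyMeasurable (by fun_prop) measurableSet_Ioi) ?_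
    filter_upwards [ae_restrict_mem measurableSet_Ioi] with τ hτ
    rw [norm_mul, Real.norm_of_nonneg (by positivity)]
    exact mul_le_mul_of_nonneg_left (hM x hx τ (le_of_lt hτ)) (by positivity)
  have hz : Tendsto (fun n : ℕ => 1 / ((n : ℝ) + 1)) atTop (𝓝 0) :=
    tendsto_one_div_add_atTop_nhds_zero_nat
  have hT : Tendsto (fun n : ℕ => (n : ℝ) + 1) atTop atTop :=
    tendsto_atTop_add_const_right _ _ tendsto_natCast_atTop_atTop
  have hexp : ∀ c : ℝ, Tendsto (fun n : ℕ => Real.exp (c * (1 / ((n : ℝ) + 1)))) atTop (𝓝 1) := by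
    intro c
    have := (Real.continuous_exp.tendsto _).comp (hz.const_mul c)
    simpa [Function.comp_def] using this
  have hexpT : Tendsto (fun n : ℕ => Real.exp (-μ * ((n : ℝ) + 1))) atTop (𝓝 0) :=
    Real.tendsto_exp_atBot.comp (hT.const_mul_atTop_of_neg (neg_lt_zero.2 hμ))
  have hE := ((((hz.const_mul 2).const_add M).mul ((hexp μ).sub (hexp (-μ)))).add
    (((hz.const_mul 2).const_add β).mul ((hexp (-μ)).sub hexpT))).sub_const β |>.max
    (((hexp μ).mul (hz.const_mul 2)).add (hexpT.mul_const M))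
  have hlim := intervalIntegral_tendsto_integral_Ioi 0 hint hT
  have hrhs := hE.const_add (β * (radialBessel a (κ 1) x / besselInt a (κ 1 * R)))
  have hfin := le_of_tendsto_of_tendsto' hlim hrhs fun n => laplace_le_add hp hN hμ ha hap hκ hR
    (T := (n : ℝ) + 1) (δ := 1 / ((n : ℝ) + 1)) (η := 1 / ((n : ℝ) + 1)) (by positivity)
    (by positivity) (by
      have h1 : (1 : ℝ) ≤ (n : ℝ) + 1 := by linarith [(Nat.cast_nonneg n : (0 : ℝ) ≤ n)]
      exact ((div_le_one (by positivity)).2 h1).trans h1) hβ hw hc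
    (fun y hy t ht => (le_abs_self _).trans (hM y hy t ht)) h0 hwβ hx
    ((intervalIntegrable_iff_integrableOn_Ioc_of_le (by positivity)).2
      (hint.mono_set Ioc_subset_Ioi_self))
  simpa using hfin

end LaplaceIdentity

/-- in the ball `B_R`, the modified Laplace transform of the solution of
problem (P) is the explicit radial function `u^ε`. -/
theorem stmt5 (N : ℕ) (hN : 2 ≤ N) (p R : ℝ) (hp : 1 < p) (hR : 0 < R)
    (u : EuclideanSpace ℝ (Fin N) → ℝ → ℝ)
    (hu : IsSolP p (Metric.ball (0 : EuclideanSpace ℝ (Fin N)) R) u) :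
    ∀ ε : ℝ, 0 < ε → ∀ x ∈ Metric.closedBall (0 : EuclideanSpace ℝ (Fin N)) R,
      (1/ε^2) * (∫ τ in Set.Ioi (0:ℝ), u x τ * Real.exp (-τ/ε^2)) = uEps N p R ε x := by
  intro ε hε x hx
  obtain ⟨⟨M, hM⟩, hc, hvis, h0, h1⟩ := hu
  rw [closure_ball _ hR.ne'] at hM hc
  rw [frontier_ball _ hR.ne'] at hc h1
  have hNe : NeZero N := ⟨by omega⟩
  have hN' : (2 : ℝ) ≤ N := by exact_mod_cast hN
  have hp0 : 0 < p - 1 := by linarith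
  have hμ : 0 < 1 / ε ^ 2 := by positivity
  have ha : -1 < ((N : ℝ) - p) / (p - 1) := by
    rw [lt_div_iff₀ hp0]
    linarith
  have hap : ((N : ℝ) - p) / (p - 1) * (p - 1) = N - p := div_mul_cancel₀ _ hp0.ne'
  set κ : ℕ → ℝ := fun k => √(p / (p - 1) * (k * (1 / ε ^ 2))) with hκdef
  have hκ : ∀ k : ℕ, κ k ^ 2 = p / (p - 1) * (k * (1 / ε ^ 2)) := fun k =>
    Real.sq_sqrt (by positivity)
  have hκ1 : κ 1 = √(p / (p - 1)) / ε := by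
    simp only [hκdef, Nat.cast_one, mul_one_div]
    rw [Real.sqrt_div' _ (by positivity), Real.sqrt_sq hε.le]
  have hM' : ∀ β : ℝ, |β| = 1 → |β| ≤ max M 1 := fun β h => h.le.trans (le_max_right _ _)
  have hup := laplace_le (β := 1) hp hN hμ ha hap hκ hR (hM' 1 (by simp))
    hvis.isViscositySubsol hc (fun y hy t ht => (hM y hy t ht).trans (le_max_left _ _)) h0 h1 hx
  have hlow := laplace_le (β := -1) hp hN hμ ha hap hκ hR (hM' (-1) (by simp))
    hvis.isViscositySubsol_neg (fun y hy t ht h => (hc y hy t ht h).neg)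
    (fun y hy t ht => by
      rw [abs_neg]
      exact (hM y hy t ht).trans (le_max_left _ _))
    (fun y hy => by rw [h0 y hy, neg_zero]) (fun y hy t ht => by rw [h1 y hy t ht]) hx
  simp only [mul_neg, integral_neg] at hlow
  have hG : uEps N p R ε x =
      radialBessel (((N : ℝ) - p) / (p - 1)) (κ 1) x /
        besselInt (((N : ℝ) - p) / (p - 1)) (κ 1 * R) := by
    rw [uEps, radialBessel, besselInt, besselInt, hκ1, div_mul_eq_mul_div, div_mul_eq_mul_div]
    simp only [mul_div_assoc]
  have hI : 1 / ε ^ 2 * ∫ τ in Ioi (0 : ℝ), u x τ * Real.exp (-τ / ε ^ 2) =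
      ∫ τ in Ioi (0 : ℝ), 1 / ε ^ 2 * Real.exp (-(1 / ε ^ 2) * τ) * u x τ := by
    rw [← integral_const_mul]
    congr 1
    funext τ
    have : -τ / ε ^ 2 = -(1 / ε ^ 2) * τ := by ring
    rw [this]
    ring
  rw [hI, hG]
  exact le_antisymm (by linarith) (by linarith)

end
end

section
/- Let N ≥ 2, 1 < p < ∞, p' = p/(p−1), R > 0, and let u be a bounded viscosity solution of problem (P) in the open ball B_R of radius R centered at the origin of ℝ^N, with u > 0 on B_R×(0,∞). Then for every x ∈ B̄_R, 4t·log u(x,t) → −p'·(R−|x|)² as t → 0⁺. -/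
open MeasureTheory Metric Set Filter
open scoped Topology ENNReal NNReal Real Classical

noncomputable section

/-- First derivative of a radial function `y ↦ G (‖y - c‖²)`. -/
lemma hasFDerivAt_radial {N : ℕ} (c : EuclideanSpace ℝ (Fin N)) {G : ℝ → ℝ} {g : ℝ}
    (x : EuclideanSpace ℝ (Fin N)) (hG : HasDerivAt G g (‖x - c‖ ^ 2)) :
    HasFDerivAt (fun y => G (‖y - c‖ ^ 2)) ((2 * g) • innerSL ℝ (x - c)) x := by
  have h1 : HasFDerivAt (fun y : EuclideanSpace ℝ (Fin N) => ‖y - c‖ ^ 2)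
      (2 • innerSL ℝ (x - c)) x := by
    simpa using ((hasFDerivAt_id x).sub_const c).norm_sq
  refine (hG.comp_hasFDerivAt x h1).congr_fderiv ?_
  ext v
  simp only [smul_apply, smul_eq_mul, nsmul_eq_mul]
  push_cast
  ring

lemma gradient_radial {N : ℕ} (c : EuclideanSpace ℝ (Fin N)) {G : ℝ → ℝ} {g : ℝ}
    (x : EuclideanSpace ℝ (Fin N)) (hG : HasDerivAt G g (‖x - c‖ ^ 2)) :
    gradient (fun y => G (‖y - c‖ ^ 2)) x = (2 * g) • (x - c) := by
  apply HasGradientAt.gradient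
  rw [hasGradientAt_iff_hasFDerivAt]
  refine (hasFDerivAt_radial c x hG).congr_fderiv ?_
  ext v
  simp

lemma hess_radial {N : ℕ} (c : EuclideanSpace ℝ (Fin N)) {G G₁ : ℝ → ℝ} {g₂ : ℝ}
    (hG : ∀ s, 0 ≤ s → HasDerivAt G (G₁ s) s) (x : EuclideanSpace ℝ (Fin N))
    (hG₁ : HasDerivAt G₁ g₂ (‖x - c‖ ^ 2)) (i j : Fin N) :
    hess (fun y => G (‖y - c‖ ^ 2)) x i j =
      2 * G₁ (‖x - c‖ ^ 2) * (if i = j then 1 else 0) +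
        4 * g₂ * (x - c) i * (x - c) j := by
  have h1 : fderiv ℝ (fun y : EuclideanSpace ℝ (Fin N) => G (‖y - c‖ ^ 2)) =
      fun y => (2 * G₁ (‖y - c‖ ^ 2)) • innerSL ℝ (y - c) := by
    funext y
    exact (hasFDerivAt_radial c y (hG _ (by positivity))).fderiv
  have h2 : HasFDerivAt (fun y : EuclideanSpace ℝ (Fin N) => innerSL ℝ (y - c))
      (innerSL ℝ) x := by
    exact (innerSL ℝ).hasFDerivAt.comp x ((hasFDerivAt_id x).sub_const c)
  have h3 := ((hasFDerivAt_radial c x hG₁).const_mul 2).smul h2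
  unfold hess
  rw [iteratedFDeriv_two_apply, h1]
  erw [h3.fderiv]
  have hij : innerSL ℝ (EuclideanSpace.single i (1 : ℝ)) (EuclideanSpace.single j (1 : ℝ)) =
      if i = j then (1 : ℝ) else 0 := by
    rw [innerSL_apply_apply]
    simp [EuclideanSpace.inner_single_left]
  simp [EuclideanSpace.inner_single_right, hij, -mul_eq_mul_right_iff, -add_right_inj]
  ring

lemma qform_radial {N : ℕ} (X : Matrix (Fin N) (Fin N) ℝ) (w v : EuclideanSpace ℝ (Fin N))
    (a b : ℝ) (hX : ∀ i j, X i j = a * (if i = j then 1 else 0) + b * w i * w j) :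
    qform X v = a * ‖v‖ ^ 2 + b * (inner ℝ w v) ^ 2 := by
  have hw : inner ℝ w v = ∑ i, w i * v i := by
    simp [PiLp.inner_apply, mul_comm]
  rw [hw, EuclideanSpace.real_norm_sq_eq, sq (∑ i, _), Finset.sum_mul_sum]
  simp only [qform, hX, Finset.mul_sum, ← Finset.sum_add_distrib]
  have : ∀ i, ∑ j, (a * (if i = j then 1 else 0) + b * w i * w j) * v j * v i =
      a * v i ^ 2 + ∑ j, b * (w i * v i * (w j * v j)) := by
    intro i
    have h : ∀ j, (a * (if i = j then 1 else 0) + b * w i * w j) * v j * v i =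
        (if i = j then a * v j * v i else 0) + b * (w i * v i * (w j * v j)) := by
      intro j
      split_ifs <;> ring
    simp only [h, Finset.sum_add_distrib, Finset.sum_ite_eq, Finset.mem_univ, if_true]
    ring
  simp only [this, Finset.sum_add_distrib]

lemma trace_radial {N : ℕ} (X : Matrix (Fin N) (Fin N) ℝ) (w : EuclideanSpace ℝ (Fin N))
    (a b : ℝ) (hX : ∀ i j, X i j = a * (if i = j then 1 else 0) + b * w i * w j) :
    X.trace = N * a + b * ‖w‖ ^ 2 := by
  rw [EuclideanSpace.real_norm_sq_eq]
  simp only [Matrix.trace, Matrix.diag, hX, if_true, Finset.sum_add_distrib, Finset.mul_sum]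
  simp [mul_assoc, sq]

/-- At a nondegenerate point, `F` of a radial function is the radial operator. -/
lemma Fop_radial {N : ℕ} (p : ℝ) (c : EuclideanSpace ℝ (Fin N)) {G G₁ : ℝ → ℝ} {g₂ : ℝ}
    (hG : ∀ s, 0 ≤ s → HasDerivAt G (G₁ s) s) (x : EuclideanSpace ℝ (Fin N))
    (hG₁ : HasDerivAt G₁ g₂ (‖x - c‖ ^ 2)) (hne : G₁ (‖x - c‖ ^ 2) ≠ 0) (hx : x ≠ c) :
    Fop p (gradient (fun y => G (‖y - c‖ ^ 2)) x) (hess (fun y => G (‖y - c‖ ^ 2)) x) =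
      (1 / p) * (2 * (N + p - 2) * G₁ (‖x - c‖ ^ 2) + 4 * (p - 1) * ‖x - c‖ ^ 2 * g₂) := by
  have hX := hess_radial c hG x hG₁
  have hn : ‖x - c‖ ≠ 0 := by simpa [sub_eq_zero] using hx
  rw [gradient_radial c x (hG _ (by positivity)), Fop, trace_radial _ _ _ _ hX,
    qform_radial _ _ _ _ _ hX, inner_smul_right, real_inner_self_eq_norm_sq, norm_smul,
    mul_pow, Real.norm_eq_abs, sq_abs]
  field_simp
  ring

lemma gradient_radial_ne_zero {N : ℕ} (c : EuclideanSpace ℝ (Fin N)) {G : ℝ → ℝ} {g : ℝ}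
    (x : EuclideanSpace ℝ (Fin N)) (hG : HasDerivAt G g (‖x - c‖ ^ 2)) (hg : g ≠ 0)
    (hx : x ≠ c) : gradient (fun y => G (‖y - c‖ ^ 2)) x ≠ 0 := by
  rw [gradient_radial c x hG]
  exact smul_ne_zero (mul_ne_zero two_ne_zero hg) (sub_ne_zero.2 hx)

lemma Flower_radial {N : ℕ} (p : ℝ) (c : EuclideanSpace ℝ (Fin N)) {G G₁ : ℝ → ℝ} {g₂ : ℝ}
    (hG : ∀ s, 0 ≤ s → HasDerivAt G (G₁ s) s) (x : EuclideanSpace ℝ (Fin N))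
    (hG₁ : HasDerivAt G₁ g₂ (‖x - c‖ ^ 2)) (hne : G₁ (‖x - c‖ ^ 2) ≠ 0) (hx : x ≠ c) :
    Flower p (gradient (fun y => G (‖y - c‖ ^ 2)) x) (hess (fun y => G (‖y - c‖ ^ 2)) x) =
      (1 / p) * (2 * (N + p - 2) * G₁ (‖x - c‖ ^ 2) + 4 * (p - 1) * ‖x - c‖ ^ 2 * g₂) := by
  rw [Flower, if_neg (gradient_radial_ne_zero c x (hG _ (by positivity)) hne hx),
    Fop_radial p c hG x hG₁ hne hx]

lemma Fupper_radial {N : ℕ} [NeZero N] (p : ℝ) (c : EuclideanSpace ℝ (Fin N))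
    {G G₁ : ℝ → ℝ} {g₂ : ℝ}
    (hG : ∀ s, 0 ≤ s → HasDerivAt G (G₁ s) s) (x : EuclideanSpace ℝ (Fin N))
    (hG₁ : HasDerivAt G₁ g₂ (‖x - c‖ ^ 2)) (hne : G₁ (‖x - c‖ ^ 2) ≠ 0) :
    Fupper p (gradient (fun y => G (‖y - c‖ ^ 2)) x) (hess (fun y => G (‖y - c‖ ^ 2)) x) =
      (1 / p) * (2 * (N + p - 2) * G₁ (‖x - c‖ ^ 2) + 4 * (p - 1) * ‖x - c‖ ^ 2 * g₂) := by
  by_cases hx : x = c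
  · have hX := hess_radial c hG x hG₁
    have hgrad : gradient (fun y => G (‖y - c‖ ^ 2)) x = 0 := by
      rw [gradient_radial c x (hG _ (by positivity)), hx, sub_self, smul_zero]
    have hset : {r | ∃ v : EuclideanSpace ℝ (Fin N), ‖v‖ = 1 ∧
        r = qform (hess (fun y => G (‖y - c‖ ^ 2)) x) v} = {2 * G₁ (‖x - c‖ ^ 2)} := by
      ext r
      have hq : ∀ v : EuclideanSpace ℝ (Fin N), ‖v‖ = 1 →
          qform (hess (fun y => G (‖y - c‖ ^ 2)) x) v = 2 * G₁ (‖x - c‖ ^ 2) := by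
        intro v hv
        rw [qform_radial _ _ _ _ _ hX, hv, hx, sub_self, inner_zero_left]
        ring
      constructor
      · rintro ⟨v, hv, rfl⟩
        exact hq v hv
      · rintro rfl
        exact ⟨EuclideanSpace.single 0 1, by simp, (hq _ (by simp)).symm⟩
    have hmm : min (p - 2) 0 + max (p - 2) 0 = p - 2 := by
      rw [min_add_max, add_zero]
    rw [Fupper, if_pos hgrad, lamMin, lamMax, hset, csInf_singleton, csSup_singleton,
      trace_radial _ _ _ _ hX]
    have h0 : ‖x - c‖ = 0 := by simp [hx]
    rw [add_assoc, ← add_mul, hmm, h0]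
    ring
  · rw [Fupper, if_neg (gradient_radial_ne_zero c x (hG _ (by positivity)) hne hx),
      Fop_radial p c hG x hG₁ hne hx]

/-- Comparison from above in a smaller ball `B_ρ(x₀)` with the explicit supersolution
`M exp (μ t + λ (√(ε² + |x - x₀|²) - ρ))`. -/
lemma le_exp_barrier {N : ℕ} [NeZero N] {p R : ℝ} (hp : 1 < p)
    {u : EuclideanSpace ℝ (Fin N) → ℝ → ℝ}
    (hu : IsSolP p (ball (0 : EuclideanSpace ℝ (Fin N)) R) u) {M : ℝ} (hM : 0 < M)
    (huM : ∀ x ∈ ball (0 : EuclideanSpace ℝ (Fin N)) R, ∀ t : ℝ, 0 ≤ t → u x t ≤ M)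
    {x₀ : EuclideanSpace ℝ (Fin N)} {ρ ε l μ : ℝ} (hρ : 0 < ρ) (hρR : ‖x₀‖ + ρ < R)
    (hε : 0 < ε) (hl : 0 < l)
    (hμ : (p - 1) / p * l ^ 2 + (N + p - 2) / p * (l / ε) < μ) {t : ℝ} (ht : 0 ≤ t) :
    u x₀ t ≤ M * Real.exp (μ * t + l * (ε - ρ)) := by
  have hp0 : 0 < p := by linarith
  have hN : (1 : ℝ) ≤ N := by exact_mod_cast NeZero.one_le
  have hμ0 : 0 < μ := by
    refine lt_of_le_of_lt ?_ hμ
    have h1 : 0 ≤ p - 1 := by linarith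
    have h2 : 0 ≤ N + p - 2 := by linarith
    positivity
  set φ : EuclideanSpace ℝ (Fin N) × ℝ → ℝ := fun q =>
    M * Real.exp (μ * q.2 + l * (√(ε ^ 2 + ‖q.1 - x₀‖ ^ 2) - ρ)) with hφ
  have hφC : ContDiff ℝ 2 φ := by
    refine contDiff_const.mul (Real.contDiff_exp.comp ?_)
    refine (contDiff_const.mul contDiff_snd).add (contDiff_const.mul (ContDiff.sub ?_ contDiff_const))
    refine ContDiff.sqrt (contDiff_const.add ((contDiff_fst.sub contDiff_const).norm_sq ℝ)) ?_
    intro q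
    positivity
  have hsub : closedBall x₀ ρ ⊆ ball (0 : EuclideanSpace ℝ (Fin N)) R := by
    intro y hy
    rw [mem_closedBall, dist_eq_norm] at hy
    rw [mem_ball_zero_iff]
    calc ‖y‖ = ‖x₀ + (y - x₀)‖ := by simp
      _ ≤ ‖x₀‖ + ‖y - x₀‖ := norm_add_le _ _
      _ < R := by linarith
  by_contra! hcon
  have hcon' : 0 < u x₀ t - φ (x₀, t) := by
    simp only [hφ, sub_self, norm_zero]
    rw [zero_pow two_ne_zero, add_zero, Real.sqrt_sq hε.le]
    linarith
  set T : ℝ := max t (l * ρ / μ)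
  have hcont : ContinuousOn (fun q : EuclideanSpace ℝ (Fin N) × ℝ => u q.1 q.2 - φ q)
      (closedBall x₀ ρ ×ˢ Icc 0 T) := by
    refine ContinuousOn.sub ?_ hφC.continuous.continuousOn
    rintro ⟨y, s⟩ ⟨hy, hs⟩
    have hyR := hsub hy
    refine (hu.2.1 y (subset_closure hyR) s hs.1 ?_).mono
      (prod_mono (hsub.trans subset_closure) Icc_subset_Ici_self)
    rintro ⟨h, -⟩
    rw [isOpen_ball.frontier_eq] at h
    exact h.2 hyR
  have hmem : (x₀, t) ∈ closedBall x₀ ρ ×ˢ Icc 0 T :=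
    ⟨mem_closedBall_self hρ.le, ht, le_max_left _ _⟩
  obtain ⟨⟨y, s⟩, ⟨hy, hs⟩, hmax⟩ :=
    ((isCompact_closedBall x₀ ρ).prod isCompact_Icc).exists_isMaxOn ⟨_, hmem⟩ hcont
  have hpos : φ (y, s) < u y s := by
    have := hmax hmem
    simp only [mem_ofPred_eq] at this
    linarith
  simp only [] at hy hs
  have hyR := hsub hy
  have huy : u y s ≤ M := huM y hyR s hs.1
  have hexp : μ * s + l * (√(ε ^ 2 + ‖y - x₀‖ ^ 2) - ρ) < 0 := by
    by_contra! h
    have := Real.one_le_exp h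
    have : M * 1 ≤ φ (y, s) := mul_le_mul_of_nonneg_left this hM.le
    linarith
  have hs0 : 0 < s := by
    rcases hs.1.eq_or_lt with h | h
    · have h0 : u y s = 0 := by rw [← h]; exact hu.2.2.2.1 y hyR
      have : 0 < φ (y, s) := by positivity
      linarith
    · exact h
  have hsT : s < T := by
    by_contra! h
    have h1 : l * ρ / μ ≤ s := (le_max_right _ _).trans h
    rw [div_le_iff₀ hμ0] at h1
    have : 0 ≤ l * √(ε ^ 2 + ‖y - x₀‖ ^ 2) := by positivity
    linarith
  have hyρ : ‖y - x₀‖ < ρ := by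
    by_contra! h
    have h1 : ‖y - x₀‖ ≤ √(ε ^ 2 + ‖y - x₀‖ ^ 2) := by
      apply Real.le_sqrt_of_sq_le
      linarith [sq_nonneg ε]
    have : 0 ≤ l * (√(ε ^ 2 + ‖y - x₀‖ ^ 2) - ρ) := mul_nonneg hl.le (by linarith)
    have : 0 < μ * s := by positivity
    linarith
  have hloc : IsLocalMaxOn (fun q : EuclideanSpace ℝ (Fin N) × ℝ => u q.1 q.2 - φ q)
      (ball (0 : EuclideanSpace ℝ (Fin N)) R ×ˢ Ioi 0) (y, s) := by
    refine IsLocalMax.on (hmax.isLocalMax ?_) _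
    refine prod_mem_nhds (Filter.mem_of_superset (isOpen_ball.mem_nhds ?_) ball_subset_closedBall)
      (Icc_mem_nhds hs0 hsT)
    rwa [mem_ball, dist_eq_norm]
  have hvis := hu.2.2.1.2.1 φ hφC y hyR s hs0 hloc
  have hdt : HasDerivAt (fun τ => φ (y, τ)) (φ (y, s) * μ) s := by
    have h1 : HasDerivAt (fun τ : ℝ => μ * τ + l * (√(ε ^ 2 + ‖y - x₀‖ ^ 2) - ρ)) μ s := by
      simpa using ((hasDerivAt_id s).const_mul μ).add_const
        (l * (√(ε ^ 2 + ‖y - x₀‖ ^ 2) - ρ))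
    exact (h1.exp.const_mul M).congr_deriv (by simp only [hφ]; ring)
  set G : ℝ → ℝ := fun r => M * Real.exp (μ * s + l * (√(ε ^ 2 + r) - ρ)) with hG
  set G₁ : ℝ → ℝ := fun r => G r * (l / (2 * √(ε ^ 2 + r))) with hG₁
  have hsq : ∀ r : ℝ, 0 ≤ r → HasDerivAt (fun r => √(ε ^ 2 + r)) (1 / (2 * √(ε ^ 2 + r))) r := by
    intro r hr
    exact ((hasDerivAt_id r).const_add _).sqrt (by simp only [id]; positivity)
  have hGd : ∀ r, 0 ≤ r → HasDerivAt G (G₁ r) r := by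
    intro r hr
    refine (((((hsq r hr).sub_const ρ).const_mul l).const_add (μ * s)).exp.const_mul M).congr_deriv
      ?_
    simp only [hG₁, hG]
    ring
  set r : ℝ := ‖y - x₀‖ ^ 2 with hr
  have hr0 : 0 ≤ r := by positivity
  set h : ℝ := √(ε ^ 2 + r) with hh
  have hh0 : 0 < h := Real.sqrt_pos.2 (by positivity)
  have hh2 : h ^ 2 = ε ^ 2 + r := Real.sq_sqrt (by positivity)
  have hεh : ε ≤ h := Real.le_sqrt_of_sq_le (by linarith)
  have hGd₁ : HasDerivAt G₁ (G r * ((l / (2 * h)) ^ 2 - l / (4 * h ^ 3))) r := by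
    have h1 := (hGd r hr0).mul
      ((((hsq r hr0).const_mul 2).inv (by positivity)).const_mul l)
    refine h1.congr_deriv ?_
    simp only [hG₁, ← hh, Pi.inv_apply]
    field_simp
    ring
  have hGpos : 0 < G r := by positivity
  have hFu := Fupper_radial p x₀ hGd y hGd₁ (by positivity)
  rw [hdt.deriv] at hvis
  have hφG : φ (y, s) = G r := rfl
  have hFG : (fun z => φ (z, s)) = fun z => G (‖z - x₀‖ ^ 2) := rfl
  rw [hφG, hFG, hFu, ← hr] at hvis
  have hval : (1 / p) * (2 * (N + p - 2) * G₁ r +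
      4 * (p - 1) * r * (G r * ((l / (2 * h)) ^ 2 - l / (4 * h ^ 3)))) =
      G r * ((p - 1) / p * (l ^ 2 * (r / h ^ 2)) + (N + p - 2) / p * (l / h)
        - (p - 1) / p * (r * l / h ^ 3)) := by
    simp only [hG₁, ← hh]
    field_simp
    ring
  rw [hval] at hvis
  have hvis' := le_of_mul_le_mul_left hvis hGpos
  have e1 : (p - 1) / p * (l ^ 2 * (r / h ^ 2)) ≤ (p - 1) / p * l ^ 2 := by
    have h1 : 0 ≤ (p - 1) / p := div_nonneg (by linarith) hp0.le
    have h2 : r / h ^ 2 ≤ 1 := by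
      rw [div_le_one (by positivity)]
      linarith [sq_nonneg ε]
    have h3 : l ^ 2 * (r / h ^ 2) ≤ l ^ 2 := mul_le_of_le_one_right (by positivity) h2
    exact mul_le_mul_of_nonneg_left h3 h1
  have e2 : (N + p - 2) / p * (l / h) ≤ (N + p - 2) / p * (l / ε) :=
    mul_le_mul_of_nonneg_left (by gcongr) (div_nonneg (by linarith) hp0.le)
  have e3 : 0 ≤ (p - 1) / p * (r * l / h ^ 3) :=
    mul_nonneg (div_nonneg (by linarith) hp0.le) (by positivity)
  linarith

/-- Comparison from below with the explicit subsolution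
`exp (-k t - a |x - z|² / √(t² + σ²)) - exp (-a ε² / σ)`, where `4 a = p'` and the pole `z` lies
outside the ball, at distance at least `ε` from it. -/
lemma gaussian_barrier_le {N : ℕ} {p R : ℝ} (hN : 2 ≤ N) (hp : 1 < p)
    {u : EuclideanSpace ℝ (Fin N) → ℝ → ℝ}
    (hu : IsSolP p (ball (0 : EuclideanSpace ℝ (Fin N)) R) u) (hR : 0 < R)
    (hupos : ∀ x ∈ ball (0 : EuclideanSpace ℝ (Fin N)) R, ∀ t : ℝ, 0 < t → 0 < u x t)
    {z : EuclideanSpace ℝ (Fin N)} {ε σ a k : ℝ} (hε : 0 < ε) (hσ : 0 < σ)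
    (hz : ∀ x ∈ closedBall (0 : EuclideanSpace ℝ (Fin N)) R, ε ≤ ‖x - z‖)
    (ha : a = p / (p - 1) / 4) (hk : 2 * a * ((N + p - 2) / p) / σ < k)
    {x₀ : EuclideanSpace ℝ (Fin N)} (hx₀ : x₀ ∈ ball (0 : EuclideanSpace ℝ (Fin N)) R)
    {t : ℝ} (ht : 0 < t) :
    Real.exp (-k * t - a * ‖x₀ - z‖ ^ 2 * (√(t ^ 2 + σ ^ 2))⁻¹) - Real.exp (-a * ε ^ 2 / σ)
      ≤ u x₀ t := by
  have hp0 : 0 < p := by linarith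
  have hp1 : 0 < p - 1 := by linarith
  have ha0 : 0 < a := by rw [ha]; positivity
  have hNR : (2 : ℝ) ≤ N := by exact_mod_cast hN
  have hC : 0 < (N + p - 2) / p := div_pos (by linarith) hp0
  have hk0 : 0 < k := lt_trans (by positivity) hk
  set c : ℝ := Real.exp (-a * ε ^ 2 / σ) with hc
  have hc0 : 0 < c := Real.exp_pos _
  set φ : EuclideanSpace ℝ (Fin N) × ℝ → ℝ := fun q =>
    Real.exp (-k * q.2 - a * ‖q.1 - z‖ ^ 2 * (√(q.2 ^ 2 + σ ^ 2))⁻¹) - c with hφ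
  have hφC : ContDiff ℝ 2 φ := by
    refine ContDiff.sub (Real.contDiff_exp.comp ?_) contDiff_const
    refine (contDiff_const.mul contDiff_snd).sub (ContDiff.mul
      (contDiff_const.mul ((contDiff_fst.sub contDiff_const).norm_sq ℝ)) (ContDiff.inv ?_ ?_))
    · refine ContDiff.sqrt ((contDiff_snd.pow 2).add contDiff_const) ?_
      intro q
      positivity
    · intro q
      positivity
  have hcl : closure (ball (0 : EuclideanSpace ℝ (Fin N)) R) = closedBall 0 R :=
    closure_ball _ hR.ne'
  have hfr : frontier (ball (0 : EuclideanSpace ℝ (Fin N)) R) = sphere 0 R :=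
    frontier_ball _ hR.ne'
  have hunn : ∀ x ∈ closedBall (0 : EuclideanSpace ℝ (Fin N)) R, ∀ s : ℝ, 0 < s → 0 ≤ u x s := by
    intro x hx s hs
    rcases (mem_closedBall.1 hx).lt_or_eq with h | h
    · exact (hupos x h s hs).le
    · rw [hu.2.2.2.2 x (by rw [hfr]; exact h) s hs]
      exact zero_le_one
  by_contra! hcon
  have hcon' : u x₀ t - φ (x₀, t) < 0 := by
    simp only [hφ]
    linarith
  set T : ℝ := max t (a * ε ^ 2 / σ / k)
  set K : Set (EuclideanSpace ℝ (Fin N) × ℝ) := closedBall 0 R ×ˢ Icc 0 T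
  -- the values of `u` at time zero are replaced by `0`, which restores semicontinuity
  set w : EuclideanSpace ℝ (Fin N) × ℝ → ℝ := fun q =>
    (if q.2 ≤ 0 then 0 else u q.1 q.2) - φ q with hw
  have hlsc : LowerSemicontinuousOn w K := by
    rintro ⟨y, s⟩ ⟨hy, hs⟩
    simp only [] at hy hs
    rcases hs.1.eq_or_lt with h | h
    · intro b hb
      have hb' : b < -φ (y, s) := by simpa [hw, ← h] using hb
      have hev : ∀ᶠ q in 𝓝[K] (y, s), b < -φ q :=
        (hφC.continuous.neg.continuousAt.eventually (lt_mem_nhds hb')).filter_mono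
          nhdsWithin_le_nhds
      filter_upwards [hev, self_mem_nhdsWithin] with q hq hqK
      have : (0 : ℝ) ≤ if q.2 ≤ 0 then 0 else u q.1 q.2 := by
        split_ifs with h'
        · exact le_rfl
        · exact hunn q.1 hqK.1 q.2 (not_le.1 h')
      simp only [hw]
      linarith
    · have h1 : ContinuousWithinAt (fun q : EuclideanSpace ℝ (Fin N) × ℝ => u q.1 q.2 - φ q)
          K (y, s) := by
        refine ContinuousWithinAt.sub ?_ hφC.continuous.continuousWithinAt
        refine (hu.2.1 y (by rwa [hcl]) s hs.1 (fun h' => h.ne' h'.2)).mono ?_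
        rw [hcl]
        exact prod_mono le_rfl Icc_subset_Ici_self
      have hpos : ∀ᶠ q : EuclideanSpace ℝ (Fin N) × ℝ in 𝓝[K] (y, s), 0 < q.2 :=
        (continuousAt_snd.eventually (lt_mem_nhds h)).filter_mono nhdsWithin_le_nhds
      refine (h1.congr_of_eventuallyEq ?_ ?_).lowerSemicontinuousWithinAt
      · filter_upwards [hpos] with q hq
        simp [hw, not_le.2 hq]
      · simp [hw, not_le.2 h]
  have hmem : (x₀, t) ∈ K := ⟨ball_subset_closedBall hx₀, ht.le, le_max_left _ _⟩
  obtain ⟨⟨y, s⟩, ⟨hy, hs⟩, hmin⟩ := hlsc.exists_isMinOn ⟨_, hmem⟩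
    ((isCompact_closedBall (0 : EuclideanSpace ℝ (Fin N)) R).prod isCompact_Icc)
  simp only [] at hy hs
  have hneg : w (y, s) < 0 := by
    have h1 : w (y, s) ≤ w (x₀, t) := hmin hmem
    have h2 : w (x₀, t) = u x₀ t - φ (x₀, t) := by simp [hw, not_le.2 ht]
    linarith
  have hzy := hz y hy
  have hs0 : 0 < s := by
    rcases hs.1.eq_or_lt with h | h
    · exfalso
      have h1 : 0 < φ (y, s) := by simpa [hw, ← h] using hneg
      have h2 : Real.exp (-k * s - a * ‖y - z‖ ^ 2 * (√(s ^ 2 + σ ^ 2))⁻¹) ≤ c := by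
        rw [← h, hc, Real.exp_le_exp, zero_pow two_ne_zero, zero_add, Real.sqrt_sq hσ.le,
          mul_zero, zero_sub, neg_mul, neg_div, neg_le_neg_iff, div_eq_mul_inv]
        gcongr
      simp only [hφ] at h1
      linarith
    · exact h
  have hwu : w (y, s) = u y s - φ (y, s) := by simp [hw, not_le.2 hs0]
  have hφpos : u y s < φ (y, s) := by linarith
  have hexp : Real.exp (-k * s - a * ‖y - z‖ ^ 2 * (√(s ^ 2 + σ ^ 2))⁻¹) ≤
      Real.exp (-k * s) := by
    rw [Real.exp_le_exp]
    have : 0 ≤ a * ‖y - z‖ ^ 2 * (√(s ^ 2 + σ ^ 2))⁻¹ := by positivity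
    linarith
  have hyR : y ∈ ball (0 : EuclideanSpace ℝ (Fin N)) R := by
    rcases (mem_closedBall.1 hy).lt_or_eq with h | h
    · exact h
    · exfalso
      have h1 := hu.2.2.2.2 y (by rw [hfr]; exact h) s hs0
      have h2 : Real.exp (-k * s) ≤ 1 := Real.exp_le_one_iff.2 (by nlinarith)
      simp only [hφ] at hφpos
      linarith
  have hsT : s < T := by
    by_contra! h
    have h1 : a * ε ^ 2 / σ / k ≤ s := (le_max_right _ _).trans h
    rw [div_le_iff₀ hk0] at h1
    have h2 : Real.exp (-k * s) ≤ c := by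
      rw [hc, Real.exp_le_exp, neg_mul, neg_mul, neg_div]
      linarith
    have h3 := hupos y hyR s hs0
    simp only [hφ] at hφpos
    linarith
  have hloc : IsLocalMinOn (fun q : EuclideanSpace ℝ (Fin N) × ℝ => u q.1 q.2 - φ q)
      (ball (0 : EuclideanSpace ℝ (Fin N)) R ×ˢ Ioi 0) (y, s) := by
    have h1 : ∀ᶠ q : EuclideanSpace ℝ (Fin N) × ℝ in 𝓝 (y, s),
        q ∈ ball (0 : EuclideanSpace ℝ (Fin N)) R ×ˢ Ioo 0 T :=
      (isOpen_ball.prod isOpen_Ioo).mem_nhds ⟨hyR, hs0, hsT⟩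
    refine IsLocalMin.on ?_ _
    filter_upwards [h1] with q hq
    have h2 : w (y, s) ≤ w q := hmin ⟨ball_subset_closedBall hq.1, hq.2.1.le, hq.2.2.le⟩
    have h3 : w q = u q.1 q.2 - φ q := by simp [hw, not_le.2 hq.2.1]
    linarith
  have hvis := hu.2.2.1.2.2 φ hφC y hyR s hs0 hloc
  set h : ℝ := √(s ^ 2 + σ ^ 2) with hh
  have hh0 : 0 < h := Real.sqrt_pos.2 (by positivity)
  set G : ℝ → ℝ := fun r => Real.exp (-k * s - a * r * h⁻¹) - c with hG
  set E : ℝ → ℝ := fun r => Real.exp (-k * s - a * r * h⁻¹) with hE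
  set r : ℝ := ‖y - z‖ ^ 2 with hr
  have hEd : ∀ b, HasDerivAt E (E b * (-a * h⁻¹)) b := by
    intro b
    have h1 : HasDerivAt (fun b : ℝ => -k * s - a * b * h⁻¹) (-(a * h⁻¹)) b := by
      simpa using (((hasDerivAt_id b).const_mul a).mul_const h⁻¹).const_sub (-k * s)
    exact h1.exp.congr_deriv (by ring)
  have hGd : ∀ b, 0 ≤ b → HasDerivAt G (E b * (-a * h⁻¹)) b := fun b _ =>
    (hEd b).sub_const c
  have hGd₁ : HasDerivAt (fun b => E b * (-a * h⁻¹)) (E r * (-a * h⁻¹) * (-a * h⁻¹)) r :=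
    (hEd r).mul_const _
  have hEpos : 0 < E r := Real.exp_pos _
  have hyz : y ≠ z := by
    rintro rfl
    rw [sub_self, norm_zero] at hzy
    linarith
  have hne : E r * (-a * h⁻¹) ≠ 0 := by
    have : -a ≠ 0 := by linarith
    positivity
  have hFl := Flower_radial p z hGd y hGd₁ hne hyz
  have hdt : HasDerivAt (fun τ => φ (y, τ)) (E r * (-k + a * r * (s / h ^ 3))) s := by
    have h0 : HasDerivAt (fun τ : ℝ => √(τ ^ 2 + σ ^ 2)) (s / h) s := by
      refine (((hasDerivAt_id s).pow 2).add_const (σ ^ 2)).sqrt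
        (by simp only [Pi.pow_apply, id]; positivity) |>.congr_deriv ?_
      simp only [Pi.pow_apply, id, ← hh]
      field_simp
      norm_num
    have h1 := ((hasDerivAt_id s).const_mul (-k)).sub ((h0.inv hh0.ne').const_mul (a * r))
    refine (h1.exp.sub_const c).congr_deriv ?_
    simp only [Pi.sub_apply, Pi.inv_apply, id, ← hh, hE]
    field_simp
    ring
  have hFG : (fun x => φ (x, s)) = fun x => G (‖x - z‖ ^ 2) := rfl
  rw [hdt.deriv, hFG, hFl, ← hr] at hvis
  have hval : (1 / p) * (2 * (N + p - 2) * (E r * (-a * h⁻¹)) +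
      4 * (p - 1) * r * (E r * (-a * h⁻¹) * (-a * h⁻¹))) =
      E r * (-(2 * a * ((N + p - 2) / p) / h) + a * r * (1 / h ^ 2)) := by
    rw [ha]
    field_simp
  rw [hval] at hvis
  have hvis' := le_of_mul_le_mul_left hvis hEpos
  have hsh : s ≤ h := Real.le_sqrt_of_sq_le (by linarith [sq_nonneg σ])
  have hσh : σ ≤ h := Real.le_sqrt_of_sq_le (by linarith [sq_nonneg s])
  have e1 : a * r * (s / h ^ 3) ≤ a * r * (1 / h ^ 2) := by
    refine mul_le_mul_of_nonneg_left ?_ (by positivity)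
    rw [div_le_div_iff₀ (by positivity) (by positivity)]
    nlinarith [mul_le_mul_of_nonneg_right hsh (sq_nonneg h)]
  have e2 : 2 * a * ((N + p - 2) / p) / h ≤ 2 * a * ((N + p - 2) / p) / σ := by
    gcongr
  linarith

lemma eventually_log_lt {N : ℕ} [NeZero N] {p R : ℝ} (hp : 1 < p)
    {u : EuclideanSpace ℝ (Fin N) → ℝ → ℝ}
    (hu : IsSolP p (ball (0 : EuclideanSpace ℝ (Fin N)) R) u)
    (hupos : ∀ x ∈ ball (0 : EuclideanSpace ℝ (Fin N)) R, ∀ t : ℝ, 0 < t → 0 < u x t)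
    {x : EuclideanSpace ℝ (Fin N)} (hx : x ∈ ball (0 : EuclideanSpace ℝ (Fin N)) R) {L : ℝ}
    (hL : -(p / (p - 1)) * (R - ‖x‖) ^ 2 < L) :
    ∀ᶠ t in 𝓝[>] (0 : ℝ), 4 * t * Real.log (u x t) < L := by
  have hp1 : 0 < p - 1 := by linarith
  have hp0 : 0 < p := by linarith
  have hxR : ‖x‖ < R := by simpa using hx
  obtain ⟨M, hM⟩ := hu.1
  set M' : ℝ := max M 1
  have hM' : 0 < M' := lt_of_lt_of_le one_pos (le_max_right _ _)
  have huM : ∀ y ∈ ball (0 : EuclideanSpace ℝ (Fin N)) R, ∀ t : ℝ, 0 ≤ t → u y t ≤ M' :=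
    fun y hy t ht => ((le_abs_self _).trans (hM y (subset_closure hy) t ht)).trans
      (le_max_left _ _)
  set q : ℝ := p / (p - 1) with hq
  have hq0 : 0 < q := by positivity
  set d : ℝ := R - ‖x‖ with hd
  have hd0 : 0 < d := by linarith
  have hε : ∀ᶠ ε in 𝓝[>] (0 : ℝ), -q * (d - ε) ^ 2 + 2 * q * (d - ε) * ε < L := by
    have hc : Continuous fun ε : ℝ => -q * (d - ε) ^ 2 + 2 * q * (d - ε) * ε := by fun_prop
    have := hc.tendsto 0
    simp only [sub_zero, mul_zero, add_zero] at this
    exact (this.mono_left nhdsWithin_le_nhds).eventually (gt_mem_nhds hL)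
  obtain ⟨ε, hεL, hεd⟩ := (hε.and (Ioo_mem_nhdsGT hd0)).exists
  have hε0 : 0 < ε := hεd.1
  set ρ : ℝ := d - ε with hρ
  have hρ0 : 0 < ρ := by linarith [hεd.2]
  set C : ℝ := (N + p - 2) / p with hC
  have hlim : ∀ᶠ t in 𝓝[>] (0 : ℝ), 4 * t * Real.log M' + 2 * C * q * ρ / ε * t + 4 * t ^ 2 +
      (-q * ρ ^ 2 + 2 * q * ρ * ε) < L := by
    have hc : Continuous fun t : ℝ => 4 * t * Real.log M' + 2 * C * q * ρ / ε * t + 4 * t ^ 2 +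
      (-q * ρ ^ 2 + 2 * q * ρ * ε) := by fun_prop
    have := hc.tendsto 0
    simp only [mul_zero, zero_mul, add_zero, zero_add, ne_eq, OfNat.ofNat_ne_zero,
      not_false_eq_true, zero_pow] at this
    exact (this.mono_left nhdsWithin_le_nhds).eventually (gt_mem_nhds hεL)
  filter_upwards [hlim, self_mem_nhdsWithin] with t htL ht
  have ht0 : 0 < t := ht
  refine lt_of_le_of_lt ?_ htL
  set l : ℝ := q * ρ / (2 * t) with hl
  have hl0 : 0 < l := by positivity
  have hbd := le_exp_barrier hp hu hM' huM (x₀ := x) (l := l)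
    (μ := (p - 1) / p * l ^ 2 + C * (l / ε) + 1) hρ0 (by linarith) hε0 hl0
    (by rw [hC]; linarith) ht0.le
  have hlog := Real.log_le_log (hupos x hx t ht0) hbd
  rw [Real.log_mul hM'.ne' (Real.exp_ne_zero _), Real.log_exp] at hlog
  refine (mul_le_mul_of_nonneg_left hlog (by positivity : 0 ≤ 4 * t)).trans_eq ?_
  have hpq : (p - 1) / p = 1 / q := by rw [hq]; field_simp
  rw [hpq, hl]
  field_simp
  ring

lemma eventually_lt_log {N : ℕ} {p R : ℝ} (hN : 2 ≤ N) (hp : 1 < p) (hR : 0 < R)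
    {u : EuclideanSpace ℝ (Fin N) → ℝ → ℝ}
    (hu : IsSolP p (ball (0 : EuclideanSpace ℝ (Fin N)) R) u)
    (hupos : ∀ x ∈ ball (0 : EuclideanSpace ℝ (Fin N)) R, ∀ t : ℝ, 0 < t → 0 < u x t)
    {x : EuclideanSpace ℝ (Fin N)} (hx : x ∈ ball (0 : EuclideanSpace ℝ (Fin N)) R) {L : ℝ}
    (hL : L < -(p / (p - 1)) * (R - ‖x‖) ^ 2) :
    ∀ᶠ t in 𝓝[>] (0 : ℝ), L < 4 * t * Real.log (u x t) := by
  have hp1 : 0 < p - 1 := by linarith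
  have hp0 : 0 < p := by linarith
  have hxR : ‖x‖ < R := by simpa using hx
  have : NeZero N := ⟨by omega⟩
  obtain ⟨e, he, hxe⟩ : ∃ e : EuclideanSpace ℝ (Fin N), ‖e‖ = 1 ∧ x = ‖x‖ • e := by
    by_cases h : x = 0
    · exact ⟨EuclideanSpace.single 0 1, by simp, by simp [h]⟩
    · have hn : ‖x‖ ≠ 0 := norm_ne_zero_iff.2 h
      exact ⟨‖x‖⁻¹ • x, norm_smul_inv_norm h, by rw [smul_smul, mul_inv_cancel₀ hn, one_smul]⟩
  set q : ℝ := p / (p - 1) with hq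
  have hq0 : 0 < q := by positivity
  set d : ℝ := R - ‖x‖ with hd
  have hd0 : 0 < d := by linarith
  have hε : ∀ᶠ ε in 𝓝[>] (0 : ℝ), L < -q * (d + ε) ^ 2 := by
    have hc : Continuous fun ε : ℝ => -q * (d + ε) ^ 2 := by fun_prop
    have := hc.tendsto 0
    simp only [add_zero] at this
    exact (this.mono_left nhdsWithin_le_nhds).eventually (lt_mem_nhds hL)
  obtain ⟨ε, hεL, hε0⟩ := (hε.and self_mem_nhdsWithin).exists
  set z : EuclideanSpace ℝ (Fin N) := (R + ε) • e with hz
  have hzn : ‖z‖ = R + ε := by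
    rw [hz, norm_smul, he, mul_one, Real.norm_of_nonneg (by linarith)]
  have hzε : ∀ y ∈ closedBall (0 : EuclideanSpace ℝ (Fin N)) R, ε ≤ ‖y - z‖ := by
    intro y hy
    rw [mem_closedBall_zero_iff] at hy
    have := norm_sub_norm_le z y
    rw [norm_sub_rev] at this
    linarith
  have hxz : ‖x - z‖ = d + ε := by
    have : x - z = (‖x‖ - (R + ε)) • e := by rw [sub_smul, ← hxe]
    rw [this, norm_smul, he, mul_one, Real.norm_eq_abs, abs_of_nonpos (by linarith)]
    ring
  set a : ℝ := q / 4 with ha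
  have ha0 : 0 < a := by positivity
  set δ : ℝ := ε ^ 2 / ((d + ε) ^ 2 + 1) with hδ
  have hδ0 : 0 < δ := by positivity
  set C : ℝ := 2 * a * ((N + p - 2) / p) / δ with hC
  have hlim : ∀ᶠ t in 𝓝[>] (0 : ℝ),
      L < -q * (d + ε) ^ 2 - 4 * t * (Real.log 2 + C + t) := by
    have hc : Continuous fun t : ℝ => -q * (d + ε) ^ 2 - 4 * t * (Real.log 2 + C + t) := by
      fun_prop
    have := hc.tendsto 0
    simp only [mul_zero, zero_mul, sub_zero] at this
    exact (this.mono_left nhdsWithin_le_nhds).eventually (lt_mem_nhds hεL)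
  have hsmall : ∀ᶠ t in 𝓝[>] (0 : ℝ), t * (Real.log 2 + C + t) < a := by
    have hc : Continuous fun t : ℝ => t * (Real.log 2 + C + t) := by fun_prop
    have := hc.tendsto 0
    simp only [zero_mul] at this
    exact (this.mono_left nhdsWithin_le_nhds).eventually (gt_mem_nhds ha0)
  filter_upwards [hlim, hsmall, self_mem_nhdsWithin] with t htL hts ht
  have ht0 : 0 < t := ht
  refine htL.trans_le ?_
  have hbd := gaussian_barrier_le hN hp hu hR hupos (z := z) (σ := δ * t) (k := C / t + 1)
    hε0 (by positivity) hzε (rfl : a = p / (p - 1) / 4)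
    (by rw [hC, div_div]; linarith) hx ht0
  set A : ℝ := -(C + t) - a * (d + ε) ^ 2 / t with hA
  have h1 : Real.exp A ≤
      Real.exp (-(C / t + 1) * t - a * ‖x - z‖ ^ 2 * (√(t ^ 2 + (δ * t) ^ 2))⁻¹) := by
    rw [Real.exp_le_exp, hxz, hA]
    have e1 : -(C / t + 1) * t = -(C + t) := by field_simp
    have e2 : (√(t ^ 2 + (δ * t) ^ 2))⁻¹ ≤ t⁻¹ :=
      inv_anti₀ ht0 (Real.le_sqrt_of_sq_le (by linarith [sq_nonneg (δ * t)]))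
    have e3 := mul_le_mul_of_nonneg_left e2 (by positivity : 0 ≤ a * (d + ε) ^ 2)
    rw [e1, div_eq_mul_inv]
    linarith
  have h2 : Real.exp (-a * ε ^ 2 / (δ * t)) ≤ Real.exp (A - Real.log 2) := by
    rw [Real.exp_le_exp, hA]
    have e1 : -a * ε ^ 2 / (δ * t) = -(a * (d + ε) ^ 2 / t) - a / t := by
      rw [hδ]
      field_simp
      ring
    have e2 : Real.log 2 + C + t ≤ a / t := by
      rw [le_div_iff₀ ht0]
      linarith
    rw [e1]
    linarith
  have h3 : Real.exp (A - Real.log 2) = Real.exp A / 2 := by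
    rw [Real.exp_sub, Real.exp_log two_pos]
  have h4 : Real.exp (A - Real.log 2) ≤ u x t := by linarith
  have h5 : A - Real.log 2 ≤ Real.log (u x t) :=
    (Real.le_log_iff_exp_le (hupos x hx t ht0)).2 h4
  refine le_trans (le_of_eq ?_) (mul_le_mul_of_nonneg_left h5 (by positivity : 0 ≤ 4 * t))
  rw [hA, ha]
  field_simp
  ring

/-- short-time asymptotics in the ball:
`4t log u(x,t) → −p' (R − |x|)²` as `t → 0⁺`, for every `x ∈ B̄_R`. -/
theorem stmt6 (N : ℕ) (hN : 2 ≤ N) (p R : ℝ) (hp : 1 < p) (hR : 0 < R)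
    (u : EuclideanSpace ℝ (Fin N) → ℝ → ℝ)
    (hu : IsSolP p (Metric.ball (0 : EuclideanSpace ℝ (Fin N)) R) u)
    (hupos : ∀ x ∈ Metric.ball (0 : EuclideanSpace ℝ (Fin N)) R, ∀ t : ℝ, 0 < t → 0 < u x t) :
    ∀ x ∈ Metric.closedBall (0 : EuclideanSpace ℝ (Fin N)) R,
      Filter.Tendsto (fun t : ℝ => 4 * t * Real.log (u x t)) (𝓝[>] (0:ℝ))
        (𝓝 (-(p/(p-1)) * (R - ‖x‖)^2)) := by
  intro x hx
  have : NeZero N := ⟨by omega⟩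
  rcases (mem_closedBall_zero_iff.1 hx).lt_or_eq with h | h
  · have hxb : x ∈ ball (0 : EuclideanSpace ℝ (Fin N)) R := by simpa using h
    exact tendsto_order.2 ⟨fun L hL => eventually_lt_log hN hp hR hu hupos hxb hL,
      fun L hL => eventually_log_lt hp hu hupos hxb hL⟩
  · rw [h, sub_self, zero_pow two_ne_zero, mul_zero]
    refine tendsto_const_nhds.congr' ?_
    filter_upwards [self_mem_nhdsWithin] with t ht
    have hxf : x ∈ frontier (ball (0 : EuclideanSpace ℝ (Fin N)) R) := by
      rw [frontier_ball _ hR.ne']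
      simpa using h
    rw [hu.2.2.2.2 x hxf t ht, Real.log_one, mul_zero]

end
end
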